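/- Suppose the HNN-extension 𝔼 = ⟨B, t; t⁻¹Ht = K, φ⟩ satisfies condition (*), 𝒞 is a root class of groups closed under taking quotient groups, H/L ∈ 𝒞, and 𝔉 ∈ 𝒞. Suppose also that at least one of the following holds: (a) B is 𝒞-quasi-regular with respect to HK, condition (†) holds, and 𝔙 ∈ 𝒞; (b) 𝒞 consists only of periodic groups, H and K are locally cyclic subgroups, and B is 𝒞-quasi-regular with respect to HK; (c) 𝒞 consists only of periodic groups, conditions (†) and (‡) hold, and B is a 𝒞-bounded nilpotent group. If B/H and B/K are residually 𝒞-groups, then 𝔼 is residually a 𝒞-group if and only if B is residually a 𝒞-group. -/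

import Mathlib

universe u

open Subgroup

/-- A class of groups in universe `u`: a property of groups. -/
abbrev GroupClass : Type (u + 1) := (G : Type u) → [inst : Group G] → Prop

/-- The class is closed under isomorphism. -/
def IsoClosed (C : GroupClass.{u}) : Prop :=
  ∀ (G₁ G₂ : Type u) [Group G₁] [Group G₂], (G₁ ≃* G₂) → C G₁ → C G₂

/-- The class is closed under taking subgroups. -/
def SubgroupClosed (C : GroupClass.{u}) : Prop :=
  ∀ (G : Type u) [Group G] (H : Subgroup G), C G → C H

/-- The class is closed under taking quotient groups. -/
def QuotClosed (C : GroupClass.{u}) : Prop :=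
  ∀ (G : Type u) [Group G] (N : Subgroup G) [N.Normal], C G → C (G ⧸ N)

/-- The class is closed under direct products of a finite number of factors. -/
def FinProdClosed (C : GroupClass.{u}) : Prop :=
  ∀ (ι : Type u) [Finite ι] (G : ι → Type u) [∀ i, Group (G i)],
    (∀ i, C (G i)) → C (∀ i, G i)

/-- Gruenberg's condition. -/
def Gruenberg (C : GroupClass.{u}) : Prop :=
  ∀ (X : Type u) [Group X] (Y Z : Subgroup X) (_ : Z ≤ Y) (hY : Y.Normal)
    (hZY : (Z.subgroupOf Y).Normal), C (X ⧸ Y) → C (↥Y ⧸ Z.subgroupOf Y) →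
    ∃ T : Subgroup X, ∃ _ : T.Normal, T ≤ Z ∧ C (X ⧸ T)

/-- A root class of groups. -/
def IsRootClass (C : GroupClass.{u}) : Prop :=
  IsoClosed C ∧ (∃ (G : Type u) (_ : Group G), C G ∧ Nontrivial G) ∧
    SubgroupClosed C ∧ Gruenberg C

/-- `X` is residually a `C`-group. -/
def Residually (C : GroupClass.{u}) (X : Type u) [Group X] : Prop :=
  ∀ x : X, x ≠ 1 → ∃ (G : Type u) (_ : Group G) (f : X →* G),
    Function.Surjective f ∧ C G ∧ f x ≠ 1

/-- Every element has finite order. -/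
def Periodic (G : Type u) [Group G] : Prop := ∀ g : G, IsOfFinOrder g

/-- The class consists only of periodic groups. -/
def PeriodicClass (C : GroupClass.{u}) : Prop := ∀ (G : Type u) [Group G], C G → Periodic G

/-- `Aut_X(Y)`: the subgroup of `Aut(Y)` consisting of the restrictions to `Y`
of the inner automorphisms of `X` (that leave `Y` invariant; when `Y` is normal
in `X` these are the restrictions of all inner automorphisms of `X`). -/
def autOf (X : Type u) [Group X] (Y : Subgroup X) : Subgroup (MulAut Y) where
  carrier := { α | ∃ x : X, ∀ y : Y, ((α y : Y) : X) = x * y * x⁻¹ }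
  one_mem' := ⟨1, fun y => by simp⟩
  mul_mem' := by
    rintro α β ⟨a, ha⟩ ⟨b, hb⟩
    refine ⟨a * b, fun y => ?_⟩
    have h1 : ((α (β y) : Y) : X) = a * (β y) * a⁻¹ := ha (β y)
    have h2 : ((β y : Y) : X) = b * y * b⁻¹ := hb y
    show ((α (β y) : Y) : X) = _
    rw [h1, h2]; group
  inv_mem' := by
    rintro α ⟨a, ha⟩
    refine ⟨a⁻¹, fun y => ?_⟩
    have h : ((α (α⁻¹ y) : Y) : X) = a * (α⁻¹ y) * a⁻¹ := ha (α⁻¹ y)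
    rw [MulAut.apply_inv_self] at h
    rw [h]; group

/-- Conjugation of automorphism groups along an isomorphism `φ : H ≃* K`,
giving `φ ∘ α ∘ φ⁻¹ : Aut K →* Aut H`. -/
def autConjHom {H K : Type u} [Group H] [Group K] (φ : H ≃* K) : MulAut K →* MulAut H where
  toFun α := (φ.trans α).trans φ.symm
  map_one' := by ext x; simp
  map_mul' := fun α β => by
    ext x
    simp [MulAut.mul_apply, MulEquiv.trans_apply, MulEquiv.apply_symm_apply]

/-- `N ∈ 𝒞*(X)`: `N` is normal in `X` and `X/N ∈ 𝒞`. -/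
def inCStar (C : GroupClass.{u}) (X : Type u) [Group X] (N : Subgroup X) : Prop :=
  ∃ _ : N.Normal, C (X ⧸ N)

/-- `X` is `𝒞`-quasi-regular with respect to its subgroup `Y`. -/
def QuasiRegular (C : GroupClass.{u}) (X : Type u) [Group X] (Y : Subgroup X) : Prop :=
  ∀ M : Subgroup Y, inCStar C Y M → ∃ N : Subgroup X, inCStar C X N ∧ N.subgroupOf Y ≤ M

/-- `𝔓(𝒞)`: the set of primes dividing the order of some element of some `𝒞`-group. -/
def primesOf (C : GroupClass.{u}) : Set ℕ :=
  { p | p.Prime ∧ ∃ (Z : Type u) (_ : Group Z), C Z ∧ ∃ z : Z, p ∣ orderOf z }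

/-- `Y` is `𝔓(𝒞)′`-isolated in `X`. -/
def PIsolated (C : GroupClass.{u}) {X : Type u} [Group X] (Y : Subgroup X) : Prop :=
  ∀ (x : X) (q : ℕ), q.Prime → q ∉ primesOf C → x ^ q ∈ Y → x ∈ Y

/-- Every finitely generated subgroup is cyclic. -/
def LocallyCyclic (G : Type u) [Group G] : Prop :=
  ∀ S : Subgroup G, S.FG → IsCyclic S

/-- `A` is a `𝒞`-bounded abelian group. -/
def CBoundedAbelian (C : GroupClass.{u}) (A : Type u) [Group A] : Prop :=
  (∀ a b : A, a * b = b * a) ∧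
  ∀ (N : Subgroup A), ∀ _ : N.Normal, ∀ p ∈ primesOf C,
    (∃ m : ℕ, 0 < m ∧ ∀ x : A ⧸ N, (∃ n : ℕ, x ^ p ^ n = 1) → x ^ m = 1) ∧
    (∃ (Z : Type u) (_ : Group Z), C Z ∧
      Cardinal.mk {x : A ⧸ N // ∃ n : ℕ, x ^ p ^ n = 1} ≤ Cardinal.mk Z)

/-- `X` is a `𝒞`-bounded nilpotent group: it has a finite central series with
`𝒞`-bounded abelian factors. -/
def CBoundedNilpotent (C : GroupClass.{u}) (X : Type u) [Group X] : Prop :=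
  ∃ (n : ℕ) (S : ℕ → Subgroup X), S 0 = ⊥ ∧ S n = ⊤ ∧
    (∀ i < n, S i ≤ S (i + 1)) ∧ (∀ i < n, (S i).Normal) ∧
    (∀ i < n, ∀ x ∈ S (i + 1), ∀ g : X, g⁻¹ * x⁻¹ * g * x ∈ S i) ∧
    (∀ i < n, ∀ _ : ((S i).subgroupOf (S (i + 1))).Normal,
      CBoundedAbelian C (↥(S (i + 1)) ⧸ (S i).subgroupOf (S (i + 1))))

/-- `A` is a normal subgroup of `U` (as subgroups of a common group). -/
def NormalIn {G : Type u} [Group G] (A U : Subgroup G) : Prop := (A.subgroupOf U).Normal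

/-- `G` satisfies a non-trivial identity. -/
def SatisfiesNontrivialIdentity (G : Type u) [Group G] : Prop :=
  ∃ w : FreeGroup ℕ, w ≠ 1 ∧ ∀ f : FreeGroup ℕ →* G, f w = 1

section HNN

variable {B : Type u} [Group B] (H K : Subgroup B) (φ : H ≃* K)

/-- `𝔎 = φ ∘ Aut_B(K) ∘ φ⁻¹`, as a subgroup of `Aut(H)`. -/
def frakK : Subgroup (MulAut H) := (autOf B K).map (autConjHom φ)

/-- `𝔘 = ⟨𝔥, 𝔎⟩ ≤ Aut(H)`. -/
def frakU : Subgroup (MulAut H) := autOf B H ⊔ frakK H K φ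

/-- `𝔙 = ⟨𝔏, 𝔉⟩ ≤ Aut(L)`, where `ψ = φ|_L`. -/
def frakV (ψ : MulAut ↥(H ⊓ K)) : Subgroup (MulAut ↥(H ⊓ K)) :=
  autOf B (H ⊓ K) ⊔ Subgroup.zpowers ψ

/-- `ψ` is the restriction of `φ` to `L = H ⊓ K` (this encodes the
`φ`-invariance of `L` from condition (*)). -/
def IsRestrictionToL (ψ : MulAut ↥(H ⊓ K)) : Prop :=
  ∀ x : ↥(H ⊓ K), ((ψ x : ↥(H ⊓ K)) : B) = ((φ ⟨(x : B), x.2.1⟩ : K) : B)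

/-- `(H ⊓ K)φ = H ⊓ K` : the `φ`-invariance of `L` from condition (*). -/
def PhiInvL : Prop :=
  ((H ⊓ K).subgroupOf H).map φ.toMonoidHom = (H ⊓ K).subgroupOf K

end HNN

section HNNExtra

variable (C : GroupClass.{u}) {B : Type u} [Group B] (H K : Subgroup B) (φ : H ≃* K)

/-- Condition (†): at least one of `𝔥` and `𝔎` is normal in `𝔘`, or `𝔘 ∈ 𝒞`. -/
def CondDag : Prop :=
  NormalIn (autOf B H) (frakU H K φ) ∨ NormalIn (frakK H K φ) (frakU H K φ) ∨
    C ↥(frakU H K φ)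

/-- Condition (‡): at least one of `𝔏` and `𝔉` is normal in `𝔙`, or `𝔙 ∈ 𝒞`. -/
def CondDDag (ψ : MulAut ↥(H ⊓ K)) : Prop :=
  NormalIn (autOf B (H ⊓ K)) (frakV H K ψ) ∨
    NormalIn (Subgroup.zpowers ψ) (frakV H K ψ) ∨ C ↥(frakV H K ψ)

/-- `Q` is a pre-`𝒞`-admissible subgroup of `B`: it is normal, `(H,K,φ)`-compatible,
`B/Q ∈ 𝒞`, and `HQ/Q ∩ KQ/Q = LQ/Q`. -/
def PreAdmissible (Q : Subgroup B) : Prop :=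
  ∃ _ : Q.Normal, ((Q ⊓ H).subgroupOf H).map φ.toMonoidHom = (Q ⊓ K).subgroupOf K ∧
    C (B ⧸ Q) ∧
    (H.map (QuotientGroup.mk' Q)) ⊓ (K.map (QuotientGroup.mk' Q)) =
      (H ⊓ K).map (QuotientGroup.mk' Q)

end HNNExtra

namespace IsRootClass

variable {C : GroupClass.{u}} (hC : IsRootClass C)

include hC

theorem of_injective {G G' : Type u} [Group G] [Group G'] (f : G →* G')
    (hf : Function.Injective f) (h : C G') : C G :=
  hC.1 _ _ (MonoidHom.ofInjective hf).symm (hC.2.2.1 _ f.range h)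

theorem of_subsingleton (G : Type u) [Group G] [Subsingleton G] : C G := by
  obtain ⟨G', _, hG', -⟩ := hC.2.1
  exact hC.of_injective (1 : G →* G') (fun a b _ => Subsingleton.elim a b) hG'

/-- Gruenberg's condition in terms of homomorphisms. -/
theorem exists_hom_of_ker_hom {X G A : Type u} [Group X] [Group G] [Group A] (f : X →* G)
    (g : f.ker →* A) (hG : C G) (hA : C A) :
    ∃ (Q : Type u) (_ : Group Q) (F : X →* Q), C Q ∧
      ∀ x, F x = 1 → ∃ h : x ∈ f.ker, g ⟨x, h⟩ = 1 := by
  have hZ : (g.ker.map f.ker.subtype).subgroupOf f.ker = g.ker :=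
    Subgroup.comap_map_eq_self_of_injective f.ker.subtype_injective _
  have hZn : ((g.ker.map f.ker.subtype).subgroupOf f.ker).Normal := by
    rw [hZ]; infer_instance
  have h1 : C (X ⧸ f.ker) :=
    hC.of_injective (QuotientGroup.kerLift f) (QuotientGroup.kerLift_injective f) hG
  have h2 : C (f.ker ⧸ (g.ker.map f.ker.subtype).subgroupOf f.ker) :=
    hC.1 _ _ (QuotientGroup.quotientMulEquivOfEq hZ).symm
      (hC.of_injective (QuotientGroup.kerLift g) (QuotientGroup.kerLift_injective g) hA)
  obtain ⟨T, hT, hTZ, hTC⟩ := hC.2.2.2 X f.ker (g.ker.map f.ker.subtype)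
    (Subgroup.map_subtype_le _) inferInstance hZn h1 h2
  refine ⟨X ⧸ T, inferInstance, QuotientGroup.mk' T, hTC, fun x hx => ?_⟩
  obtain ⟨y, hy, rfl⟩ := hTZ ((QuotientGroup.eq_one_iff x).1 hx)
  exact ⟨y.2, hy⟩

theorem of_ker {X G : Type u} [Group X] [Group G] (f : X →* G) (hG : C G) (hf : C f.ker) :
    C X := by
  obtain ⟨Q, _, F, hQ, hF⟩ := hC.exists_hom_of_ker_hom f (MonoidHom.id _) hG hf
  refine hC.of_injective F ((injective_iff_map_eq_one F).2 fun x hx => ?_) hQ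
  obtain ⟨h, h1⟩ := hF x hx
  exact congrArg Subtype.val h1

theorem prod {G A : Type u} [Group G] [Group A] (hG : C G) (hA : C A) : C (G × A) := by
  refine hC.of_ker (MonoidHom.fst G A) hG
    (hC.of_injective ((MonoidHom.snd G A).comp (MonoidHom.fst G A).ker.subtype) ?_ hA)
  refine (injective_iff_map_eq_one _).2 ?_
  rintro ⟨⟨x, y⟩, hx⟩ hy
  exact Subtype.ext (Prod.ext hx hy)

theorem wreath {G A : Type u} [Group G] [Group A] (hA : C A) (hG : C G) : C (A ≀ᵣ G) := by
  let g : (RegularWreathProduct.rightHom : A ≀ᵣ G →* G).ker →* A :=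
    { toFun := fun w => w.1.left 1
      map_one' := rfl
      map_mul' := by
        rintro ⟨a, ha : a.right = 1⟩ ⟨b, hb⟩
        simp [ha] }
  obtain ⟨Q, _, F, hQ, hF⟩ := hC.exists_hom_of_ker_hom _ g hG hA
  refine hC.of_injective F ((injective_iff_map_eq_one F).2 fun x hx => ?_) hQ
  obtain ⟨h, -⟩ := hF x hx
  refine RegularWreathProduct.ext (funext fun y => ?_) h
  have hx' : F ((RegularWreathProduct.inl y)⁻¹ * x * RegularWreathProduct.inl y) = 1 := by
    simp [hx]
  obtain ⟨_, h1⟩ := hF _ hx'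
  simpa [g] using h1

theorem pi {G A : Type u} [Group G] [Group A] (hA : C A) (hG : C G) : C (G → A) := by
  let f : (G → A) →* A ≀ᵣ G :=
    { toFun := fun w => ⟨w, 1⟩
      map_one' := rfl
      map_mul' := fun a b => by ext <;> simp }
  exact hC.of_injective f (fun a b h => congrArg RegularWreathProduct.left h) (hC.wreath hA hG)

theorem exists_exponent (hper : PeriodicClass C) {G : Type u} [Group G] (hG : C G) :
    ∃ n : ℕ, 0 < n ∧ ∀ g : G, g ^ n = 1 := by
  obtain ⟨n, hn, h⟩ := isOfFinOrder_iff_pow_eq_one.1 (hper _ (hC.pi hG hG) (id : G → G))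
  exact ⟨n, hn, fun g => congrFun h g⟩

theorem of_isPGroup {p : ℕ} (hp : p.Prime) (hCp : C (ULift.{u} (Multiplicative (ZMod p))))
    (n : ℕ) : ∀ (G : Type u) [Group G] [Finite G], Nat.card G ≤ n → IsPGroup p G → C G := by
  have : Fact p.Prime := ⟨hp⟩
  induction n with
  | zero =>
    intro G _ _ hn _
    exact absurd hn (Nat.not_le.2 Nat.card_pos)
  | succ n ih =>
    intro G _ _ hn hG
    rcases subsingleton_or_nontrivial G with h | h
    · exact hC.of_subsingleton G
    have := hG.center_nontrivial
    obtain ⟨z, hz⟩ := exists_ne (1 : center G)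
    have hzp := (hG.to_subgroup (center G)).dvd_orderOf hz
    set y : center G := z ^ (orderOf z / p) with hy
    have hyp : orderOf (y : G) = p := by
      rw [Subgroup.orderOf_coe, hy, orderOf_pow_orderOf_div (orderOf_pos z).ne' hzp]
    have hle : zpowers (y : G) ≤ center G := by
      rw [zpowers_le]; exact y.2
    have hN : (zpowers (y : G)).Normal := by
      refine ⟨fun n hn g => ?_⟩
      rw [(mem_center_iff.1 (hle hn) g), mul_inv_cancel_right]
      exact hn
    have hcard : Nat.card (zpowers (y : G)) = p := by rw [Nat.card_zpowers, hyp]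
    have hCN : C (zpowers (y : G)) := by
      refine hC.1 _ _ (MulEquiv.ulift.trans (mulEquivOfCyclicCardEq ?_)) hCp
      rw [hcard]
      simp
    refine hC.of_ker (QuotientGroup.mk' (zpowers (y : G))) (ih _ ?_ (hG.to_quotient _)) ?_
    · have h1 := card_eq_card_quotient_mul_card_subgroup (zpowers (y : G))
      rw [hcard] at h1
      have h2 : 0 < Nat.card (G ⧸ zpowers (y : G)) := Nat.card_pos
      have h3 := hp.two_le
      nlinarith
    · rwa [QuotientGroup.ker_mk']

variable (hquot : QuotClosed C)
include hquot

theorem of_surjective {G G' : Type u} [Group G] [Group G'] (f : G →* G')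
    (hf : Function.Surjective f) (h : C G) : C G' :=
  hC.1 _ _ (QuotientGroup.quotientKerEquivOfSurjective f hf) (hquot _ f.ker h)

theorem of_hom_le {X G G' : Type u} [Group X] [Group G] [Group G'] (f : X →* G) (hG : C G)
    (g : X →* G') (hg : Function.Surjective g) (hle : ∀ x, f x = 1 → g x = 1) : C G' := by
  refine hC.of_surjective hquot (QuotientGroup.lift f.ker g fun x hx => hle x hx)
    (fun y => ?_) (hC.of_injective (QuotientGroup.kerLift f)
      (QuotientGroup.kerLift_injective f) hG)
  obtain ⟨x, rfl⟩ := hg y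
  exact ⟨x, rfl⟩

theorem zmod_of_dvd_orderOf {G : Type u} [Group G] (hG : C G) (g : G) (p : ℕ)
    (hp : p ∣ orderOf g) : C (ULift.{u} (Multiplicative (ZMod p))) := by
  have h1 : p ∣ Nat.card (zpowers g) := by rwa [Nat.card_zpowers]
  let f : zpowers g →* ULift.{u} (Multiplicative (ZMod p)) :=
    (MulEquiv.ulift.symm.toMonoidHom.comp
      (AddMonoidHom.toMultiplicative (ZMod.castHom h1 (ZMod p)).toAddMonoidHom)).comp
      (zmodCyclicMulEquiv (inferInstance : IsCyclic (zpowers g))).symm.toMonoidHom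
  refine hC.of_surjective hquot f ?_ (hC.2.2.1 _ _ hG)
  refine (MulEquiv.ulift.symm.surjective.comp ?_).comp (MulEquiv.surjective _)
  intro y
  obtain ⟨x, hx⟩ := ZMod.castHom_surjective h1 y.toAdd
  exact ⟨Multiplicative.ofAdd x, congrArg Multiplicative.ofAdd hx⟩

theorem exists_prime_zmod :
    ∃ p : ℕ, p.Prime ∧ C (ULift.{u} (Multiplicative (ZMod p))) := by
  obtain ⟨G, _, hG, hnt⟩ := hC.2.1
  obtain ⟨g, hg⟩ := exists_ne (1 : G)
  obtain ⟨p, hp, hpg⟩ := Nat.exists_prime_and_dvd (mt orderOf_eq_one_iff.1 hg)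
  exact ⟨p, hp, hC.zmod_of_dvd_orderOf hquot hG g p hpg⟩

end IsRootClass

section FreeGroupResidual

variable {p n : ℕ}

/-- The matrices that vanish on and below the diagonal. -/
def StrictUpper (N : Matrix (Fin n) (Fin n) (ZMod p)) : Prop :=
  ∀ i j, j ≤ i → N i j = 0

theorem StrictUpper.pow_apply {N : Matrix (Fin n) (Fin n) (ZMod p)} (hN : StrictUpper N) (k : ℕ) :
    ∀ i j : Fin n, (j : ℕ) < i + k → (N ^ k) i j = 0 := by
  induction k with
  | zero =>
    intro i j h
    rw [pow_zero, Matrix.one_apply_ne (by rintro rfl; omega)]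
  | succ k ih =>
    intro i j h
    rw [pow_succ, Matrix.mul_apply]
    refine Finset.sum_eq_zero fun l _ => ?_
    by_cases hl : (l : ℕ) < i + k
    · rw [ih i l hl, zero_mul]
    · rw [hN l j (by rw [Fin.le_def]; omega), mul_zero]

theorem StrictUpper.one_add_pow [Fact p.Prime] {N : Matrix (Fin n) (Fin n) (ZMod p)}
    (hN : StrictUpper N) : (1 + N) ^ p ^ n = 1 := by
  rcases Nat.eq_zero_or_pos n with rfl | hn
  · exact Subsingleton.elim _ _
  have : Nonempty (Fin n) := ⟨⟨0, hn⟩⟩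
  rw [add_pow_char_pow_of_commute (p := p) (h := Commute.one_left N), one_pow, add_eq_left]
  ext i j
  refine hN.pow_apply _ i j ?_
  have := (Nat.lt_pow_self (n := n) (Fact.out : p.Prime).one_lt)
  omega

theorem StrictUpper.mul_sub_one {M N : Matrix (Fin n) (Fin n) (ZMod p)}
    (hM : StrictUpper (M - 1)) (hN : StrictUpper (N - 1)) : StrictUpper (M * N - 1) := by
  have h : M * N - 1 = (M - 1) * (N - 1) + (M - 1) + (N - 1) := by noncomm_ring
  intro i j hij
  rw [h, Matrix.add_apply, Matrix.add_apply, hM i j hij, hN i j hij, Matrix.mul_apply,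
    add_zero, add_zero]
  refine Finset.sum_eq_zero fun l _ => ?_
  rcases le_total l i with hl | hl
  · rw [hM i l hl, zero_mul]
  · rw [hN l j (hij.trans hl), mul_zero]

variable (p n) in
/-- The group of upper unitriangular matrices over `ZMod p`. -/
def unitriangular [Fact p.Prime] : Subgroup (Matrix (Fin n) (Fin n) (ZMod p))ˣ where
  carrier := {u | StrictUpper ((u : Matrix (Fin n) (Fin n) (ZMod p)) - 1)}
  one_mem' := fun i j _ => by simp
  mul_mem' := fun {a b} ha hb => by
    simpa using StrictUpper.mul_sub_one ha hb
  inv_mem' := by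
    intro u hu
    have h1 : u ^ p ^ n = 1 := by
      ext1
      have := StrictUpper.one_add_pow hu
      rw [add_sub_cancel] at this
      simpa using this
    have h2 : u⁻¹ = u ^ (p ^ n - 1) := by
      rw [inv_eq_iff_mul_eq_one, ← pow_succ', Nat.sub_add_cancel, h1]
      exact pow_pos (Fact.out : p.Prime).pos _
    rw [h2]
    generalize p ^ n - 1 = m
    induction m with
    | zero => exact fun i j _ => by simp
    | succ m ih =>
      have := StrictUpper.mul_sub_one ih hu
      simpa [pow_succ] using this

theorem isPGroup_unitriangular [Fact p.Prime] : IsPGroup p (unitriangular p n) := by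
  rintro ⟨u, hu⟩
  refine ⟨n, ?_⟩
  ext1
  ext1
  have := StrictUpper.one_add_pow hu
  rw [add_sub_cancel] at this
  simpa using this

variable {α : Type u} (L : List (α × Bool))

open Classical in
/-- The matrix `1 + ∑ E i (i + 1)`, the sum being over the positions `i` at which the letter of
the word `L` equals `x`. -/
noncomputable def edgeMatrix (p : ℕ) (x : α × Bool) :
    Matrix (Fin (L.length + 1)) (Fin (L.length + 1)) (ZMod p) :=
  1 + Matrix.of fun i j : Fin (L.length + 1) => if (j : ℕ) = i + 1 ∧ L[(i : ℕ)]? = some x then 1 else 0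

open Classical in
theorem mul_edgeMatrix_apply (x : α × Bool)
    (A : Matrix (Fin (L.length + 1)) (Fin (L.length + 1)) (ZMod p)) (a i k : Fin (L.length + 1))
    (hk : (k : ℕ) = i + 1) :
    (A * edgeMatrix L p x) a k = A a k + if L[(i : ℕ)]? = some x then A a i else 0 := by
  rw [edgeMatrix, mul_add, mul_one, Matrix.add_apply, Matrix.mul_apply, Finset.sum_eq_single i]
  · simp [hk]
  · intro b _ hb
    have : ¬ ((k : ℕ) = b + 1) := fun h => hb (Fin.ext (by omega))
    simp [this]
  · simp

theorem strictUpper_edgeMatrix (x : α × Bool) : StrictUpper (edgeMatrix L p x - 1) := by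
  intro i j hij
  have : ¬ ((j : ℕ) = i + 1) := by rw [Fin.le_def] at hij; omega
  simp [edgeMatrix, this]

/-- The matrix `edgeMatrix L p x` as an element of the unitriangular group. -/
noncomputable def edgeUnit (p : ℕ) [Fact p.Prime] (x : α × Bool) :
    unitriangular p (L.length + 1) :=
  ⟨Units.ofPowEqOne (edgeMatrix L p x) (p ^ (L.length + 1)) (by
    have := StrictUpper.one_add_pow (strictUpper_edgeMatrix (p := p) L x)
    rwa [add_sub_cancel] at this) (pow_pos (Fact.out : p.Prime).pos _).ne',
    strictUpper_edgeMatrix L x⟩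

open Classical in
theorem exists_isPGroup_lift_ne_one [Fact p.Prime] (hL : FreeGroup.IsReduced L) (hne : L ≠ []) :
    ∃ (X : Type) (_ : Group X) (_ : Finite X) (σ : α → X), IsPGroup p X ∧
      FreeGroup.lift σ (FreeGroup.mk L) ≠ 1 := by
  let σ : α → unitriangular p (L.length + 1) :=
    fun s => edgeUnit L p (s, true) * (edgeUnit L p (s, false))⁻¹
  refine ⟨unitriangular p (L.length + 1), inferInstance, inferInstance, σ,
    isPGroup_unitriangular, fun h1 => ?_⟩
  let P : List (α × Bool) → unitriangular p (L.length + 1) :=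
    fun l => (l.map fun x => cond x.2 (σ x.1) (σ x.1)⁻¹).prod
  let R : ℕ → Matrix (Fin (L.length + 1)) (Fin (L.length + 1)) (ZMod p) :=
    fun k => (P (L.take k)).1.1
  have hR : ∀ (j : ℕ) (s : α) (e : Bool), L[j]? = some (s, e) →
      R (j + 1) * edgeMatrix L p (s, !e) = R j * edgeMatrix L p (s, e) := by
    intro j s e hj
    have h2 : P (L.take (j + 1)) * edgeUnit L p (s, !e) =
        P (L.take j) * edgeUnit L p (s, e) := by
      have : L.take (j + 1) = L.take j ++ [(s, e)] := by
        rw [List.take_add_one, hj]; rfl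
      rw [this]
      cases e <;> simp [P, σ, mul_assoc]
    exact congrArg (fun u : unitriangular p (L.length + 1) =>
      u.1.1) h2
  have key : ∀ k : ℕ, ∀ hk : k < L.length + 1, R k 0 ⟨k, hk⟩ = 1 ∧
      ∀ i : Fin (L.length + 1), k < i → R k 0 i = 0 := by
    intro k
    induction k with
    | zero =>
      intro hk
      have : R 0 = 1 := by simp [R, P]
      rw [this]
      refine ⟨Matrix.one_apply_eq _, fun i hi => Matrix.one_apply_ne ?_⟩
      rintro rfl
      simp at hi
    | succ k ih =>
      intro hk
      obtain ⟨ih1, ih2⟩ := ih (by omega)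
      have hkL : k < L.length := by omega
      have hj : L[k]? = some ((L[k]).1, (L[k]).2) := by simp [hkL]
      set s := (L[k]).1
      set e := (L[k]).2
      have hRk := hR k s e hj
      have hentry : ∀ m (hm : m + 1 < L.length + 1), R (k + 1) 0 ⟨m + 1, hm⟩ +
          (if L[m]? = some (s, !e) then R (k + 1) 0 ⟨m, by omega⟩ else 0) =
          R k 0 ⟨m + 1, hm⟩ + (if L[m]? = some (s, e) then R k 0 ⟨m, by omega⟩ else 0) := by
        intro m hm
        have := congrFun (congrFun hRk 0) ⟨m + 1, hm⟩
        rw [mul_edgeMatrix_apply L _ _ 0 ⟨m, by omega⟩ _ rfl,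
          mul_edgeMatrix_apply L _ _ 0 ⟨m, by omega⟩ _ rfl] at this
        simpa using this
      refine ⟨?_, ?_⟩
      · have := hentry k hk
        rw [hj, ih2 ⟨k + 1, hk⟩ (by simp), ih1] at this
        simpa using this
      · have hz : ∀ m (hm : m + 1 < L.length + 1), k < m → R (k + 1) 0 ⟨m + 1, hm⟩ = 0 := by
          intro m
          induction m with
          | zero => intro _ h; omega
          | succ m ihm =>
            intro hm hkm
            have := hentry (m + 1) hm
            rw [ih2 ⟨m + 1 + 1, hm⟩ (by simp; omega), ih2 ⟨m + 1, by omega⟩ (by simp; omega)] at this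
            simp only [ite_self, add_zero] at this
            rcases Nat.lt_or_ge k m with h | h
            · rw [ihm (by omega) h] at this
              simpa using this
            · obtain rfl : k = m := by omega
              have hne : L[k + 1]? ≠ some (s, !e) := by
                intro hc
                have hlt : k + 1 < L.length := by omega
                have h3 := List.isChain_iff_getElem.1 hL k hlt
                rw [List.getElem?_eq_getElem hlt, Option.some_inj] at hc
                rw [hc] at h3
                have := h3 rfl
                simp [e] at this
              rw [if_neg hne] at this
              simpa using this
        intro i hi
        obtain ⟨i, hi'⟩ := i
        obtain ⟨m, rfl⟩ : ∃ m, i = m + 1 := ⟨i - 1, by simp at hi; omega⟩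
        exact hz m hi' (by simp at hi; omega)
  have h4 := (key L.length (by omega)).1
  have h5 : R L.length = 1 := by
    have : P L = 1 := by
      rw [← h1, FreeGroup.lift_mk]
    simp [R, this]
  rw [h5, Matrix.one_apply_ne] at h4
  · exact zero_ne_one h4
  · intro h
    exact hne (List.length_eq_zero_iff.1 (Fin.ext_iff.1 h).symm)

theorem IsRootClass.exists_freeGroup_hom {C : GroupClass.{u}} (hC : IsRootClass C)
    (hquot : QuotClosed C) {L : List (α × Bool)} (hL : FreeGroup.IsReduced L) (hne : L ≠ []) :
    ∃ (X : Type u) (_ : Group X) (f : FreeGroup α →* X), C X ∧ f (FreeGroup.mk L) ≠ 1 := by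
  obtain ⟨p, hp, hCp⟩ := hC.exists_prime_zmod hquot
  have : Fact p.Prime := ⟨hp⟩
  obtain ⟨X, _, _, σ, hX, h⟩ := exists_isPGroup_lift_ne_one (p := p) L hL hne
  refine ⟨ULift.{u} X, inferInstance, MulEquiv.ulift.symm.toMonoidHom.comp (FreeGroup.lift σ),
    hC.of_isPGroup hp hCp _ _ le_rfl (hX.of_equiv MulEquiv.ulift.symm), fun h1 => h ?_⟩
  exact MulEquiv.ulift.symm.injective (h1.trans (map_one _).symm)

end FreeGroupResidual

section Orbits

variable {B G : Type*} [Group B] [Group G]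

theorem exists_orbit_section (f : B →* G) :
    ∃ β : G → B, ∀ b y, (f (β (f b * y)))⁻¹ * (f b * y) = (f (β y))⁻¹ * y := by
  let s : G → G := fun y => Quotient.out (s := QuotientGroup.rightRel f.range) (Quotient.mk _ y)
  have hs : ∀ y, ∃ b, f b = y * (s y)⁻¹ := fun y =>
    QuotientGroup.rightRel_apply.1 (Quotient.mk_out (s := QuotientGroup.rightRel f.range) y)
  choose β hβ using hs
  have hβ' : ∀ y, (f (β y))⁻¹ * y = s y := fun y => by rw [hβ]; group
  refine ⟨β, fun b y => ?_⟩
  rw [hβ', hβ']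
  exact congrArg Quotient.out (Quotient.sound (s := QuotientGroup.rightRel f.range)
    (QuotientGroup.rightRel_apply.2 ⟨b⁻¹, by rw [map_inv]; group⟩))

theorem exists_coset_label (f : B →* G) :
    ∃ r : G → G, (∀ b y, r (f b * y) = r y) ∧ ∀ y z, r y = r z → ∃ b, z = f b * y := by
  obtain ⟨β, hβ⟩ := exists_orbit_section f
  refine ⟨fun y => (f (β y))⁻¹ * y, hβ, fun y z h => ⟨β z * (β y)⁻¹, ?_⟩⟩
  have h' : (f (β y))⁻¹ * y = (f (β z))⁻¹ * z := h
  rw [map_mul, map_inv, mul_assoc, h', mul_inv_cancel_left]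

end Orbits

namespace HNNExtension

variable {B G X : Type*} [Group B] [Group G] [Group X] {H K : Subgroup B} {φ : H ≃* K}

theorem exists_hom_of_cocycle (f : HNNExtension B H K φ →* G) (l : B → G → X)
    (hl : ∀ b b' y, l (b * b') y = l b (f (of b') * y) * l b' y) (c : G → X)
    (hc : ∀ (h : H) (y : G), c (f (of h.1) * y) * l h y = l (φ h) (f t * y) * c y) :
    ∃ F : HNNExtension B H K φ →* X ≀ᵣ G,
      (∀ b, F (of b) = ⟨fun z => l b ((f (of b))⁻¹ * z), f (of b)⟩) ∧
      F t = ⟨fun z => c ((f t)⁻¹ * z), f t⟩ := by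
  have hl1 : ∀ y, l 1 y = 1 := fun y => by
    have := hl 1 1 y
    rw [mul_one, map_one, map_one, one_mul] at this
    exact left_eq_mul.1 this
  let FB : B →* X ≀ᵣ G :=
    { toFun := fun b => ⟨fun z => l b ((f (of b))⁻¹ * z), f (of b)⟩
      map_one' := by
        refine RegularWreathProduct.ext (funext fun z => ?_) ?_
        · simp [hl1]
        · simp
      map_mul' := fun a b => by
        refine RegularWreathProduct.ext (funext fun z => ?_) ?_
        · simp [hl, mul_assoc]
        · simp }
  refine ⟨lift FB ⟨fun z => c ((f t)⁻¹ * z), f t⟩ fun h => ?_, fun b => lift_of _ _ _ _,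
    lift_t _ _ _⟩
  have hth : f t * f (of h.1) = f (of (φ h : B)) * f t := by
    rw [← map_mul, ← map_mul, t_mul_of]
  refine RegularWreathProduct.ext (funext fun z => ?_) hth
  have := hc h ((f (of h.1))⁻¹ * ((f t)⁻¹ * z))
  have h2 : (f t)⁻¹ * ((f (of (φ h : B)))⁻¹ * z) = (f (of h.1))⁻¹ * ((f t)⁻¹ * z) := by
    rw [← mul_assoc, ← mul_assoc, ← mul_inv_rev, ← mul_inv_rev, hth]
  have h3 : f t * ((f (of h.1))⁻¹ * ((f t)⁻¹ * z)) = (f (of (φ h : B)))⁻¹ * z := by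
    rw [← h2, mul_inv_cancel_left]
  rw [mul_inv_cancel_left, h3] at this
  simpa [FB, h2] using this

/-- A homomorphism `f` of an HNN-extension extends along a map `ρ` of the kernel `D` of `f` in the
base group, provided that conjugation by the elements of the base group and by the stable
letter is realized on the image of `ρ` by inner automorphisms. -/
theorem exists_hom_wreath (f : HNNExtension B H K φ →* G) (D : Subgroup B)
    (hD : ∀ b, f (of b) = 1 ↔ b ∈ D) (ρ : B → X)
    (hρ : ∀ d ∈ D, ∀ d' ∈ D, ρ (d * d') = ρ d * ρ d')
    (hρB : ∀ b, ∃ x, ∀ d ∈ D, ρ (b * d * b⁻¹) = x * ρ d * x⁻¹)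
    (xt : X) (hρt : ∀ h : H, (h : B) ∈ D → ρ (φ h) = xt * ρ h * xt⁻¹) :
    ∃ F : HNNExtension B H K φ →* X ≀ᵣ G, ∀ b, F (of b) = 1 ↔ b ∈ D ∧ ρ b = 1 := by
  choose x hx using hρB
  obtain ⟨β, hβ⟩ := exists_orbit_section (f.comp of)
  obtain ⟨η, hη⟩ := exists_orbit_section ((f.comp of).comp H.subtype)
  simp only [MonoidHom.comp_apply, Subgroup.subtype_apply] at hβ hη
  have hmem : ∀ b y, (β (f (of b) * y))⁻¹ * b * β y ∈ D := fun b y => by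
    rw [← hD]
    have := hβ b y
    rw [← mul_assoc] at this
    have := mul_right_cancel this
    simp only [map_mul, map_inv]
    rw [this, inv_mul_cancel]
  let l : B → G → X := fun b y =>
    x (β (f (of b) * y)) * ρ ((β (f (of b) * y))⁻¹ * b * β y) * (x (β y))⁻¹
  have hl : ∀ b b' y, l (b * b') y = l b (f (of b') * y) * l b' y := by
    intro b b' y
    have h1 := hρ _ (hmem b (f (of b') * y)) _ (hmem b' y)
    have h2 : (β (f (of b) * (f (of b') * y)))⁻¹ * b * β (f (of b') * y) *
        ((β (f (of b') * y))⁻¹ * b' * β y) =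
        (β (f (of (b * b')) * y))⁻¹ * (b * b') * β y := by
      rw [map_mul of, map_mul f, mul_assoc (f _)]; group
    rw [h2] at h1
    simp only [l]
    rw [h1, map_mul of, map_mul f, mul_assoc (f _)]
    group
  have hlD : ∀ d ∈ D, ∀ y, l d y = ρ d := by
    intro d hd y
    have h1 : f (of d) = 1 := (hD d).2 hd
    have hd' : (β y)⁻¹ * d * β y ∈ D := by
      have := hmem d y
      rwa [h1, one_mul] at this
    have h2 := hx (β y) _ hd'
    simp only [l]
    rw [h1, one_mul, ← h2]
    group
  have hft : ∀ h : H, f t * f (of h.1) = f (of (φ h : B)) * f t := fun h => by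
    rw [← map_mul, ← map_mul, t_mul_of]
  have hDφ : ∀ h : H, (h : B) ∈ D → (φ h : B) ∈ D := fun h hh => by
    rw [← hD, equiv_eq_conj, map_mul, map_mul, (hD _).2 hh, map_inv, mul_one, mul_inv_cancel]
  let r : G → G := fun y => (f (of (η y).1))⁻¹ * y
  have hr : ∀ y, f (of (η y).1) * r y = y := fun y => mul_inv_cancel_left _ _
  let c : G → X := fun y => l (φ (η y)) (f t * r y) * xt * (l (η y) (r y))⁻¹
  have hc : ∀ (h : H) (y : G), c (f (of h.1) * y) * l h y = l (φ h) (f t * y) * c y := by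
    intro h y
    have hry : r (f (of h.1) * y) = r y := hη h y
    obtain ⟨d, hd⟩ : ∃ d, η (f (of h.1) * y) = h * η y * d := 
      ⟨(h * η y)⁻¹ * η (f (of h.1) * y), (mul_inv_cancel_left _ _).symm⟩
    have hdD : (d : B) ∈ D := by
      have h1 := hr (f (of h.1) * y)
      rw [hry, hd] at h1
      have h2 : f (of h.1) * f (of (η y).1) * f (of d.1) * r y
          = f (of h.1) * f (of (η y).1) * 1 * r y := by
        simpa [mul_assoc, hr] using h1
      exact (hD _).1 (mul_left_cancel (mul_right_cancel h2))
    have h3 : f (of d.1) * r y = r y := by rw [(hD _).2 hdD, one_mul]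
    have h4 : f (of (φ d : B)) * (f t * r y) = f t * r y := by
      rw [(hD _).2 (hDφ d hdD), one_mul]
    have h5 : f (of (φ (η y) : B)) * (f t * r y) = f t * y := by
      rw [← mul_assoc, ← hft, mul_assoc, hr]
    simp only [c]
    rw [hry, hd]
    simp only [map_mul φ, Subgroup.coe_mul, hl]
    rw [h3, h4, h5, hr, hlD _ hdD, hlD _ (hDφ d hdD), hρt d hdD]
    group
  obtain ⟨F, hF, -⟩ := exists_hom_of_cocycle f l hl c hc
  refine ⟨F, fun b => ?_⟩
  rw [hF]
  constructor
  · intro h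
    have hb := (hD b).1 (congrArg RegularWreathProduct.right h)
    refine ⟨hb, ?_⟩
    have := congrFun (congrArg RegularWreathProduct.left h) 1
    simpa [hlD _ hb] using this
  · rintro ⟨hb, h1⟩
    refine RegularWreathProduct.ext (funext fun z => ?_) ((hD b).2 hb)
    simp [hlD _ hb, h1]

end HNNExtension

namespace HNNExtension
open NormalWord

variable {B G : Type*} [Group B] [Group G] {H K : Subgroup B} {φ : H ≃* K}

/-- The word in the free group traced by a path, starting at `z`, in the graph whose edges are the
cosets labelled by `r`. -/
def pathWord (f : HNNExtension B H K φ →* G) (r : G → G) :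
    List (ℤˣ × B) → G → List (G × Bool)
  | [], _ => []
  | x :: l, z => (if x.1 = 1 then (r ((f t)⁻¹ * z), true) else (r z, false)) ::
      pathWord f r l ((f (t ^ (x.1 : ℤ) * of x.2))⁻¹ * z)

theorem isReduced_pathWord (f : HNNExtension B H K φ →* G) (r : G → G)
    (hr : ∀ y z, r y = r z → ∃ h : H, z = f (of h.1) * y) (l : List (ℤˣ × B))
    (hl : l.IsChain (fun a b => a.2 ∈ toSubgroup H K a.1 → a.1 = b.1))
    (hsep : ∀ x ∈ l, x.2 ∉ toSubgroup H K x.1 →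
      ∀ a ∈ toSubgroup H K x.1, f (of x.2) ≠ f (of a)) :
    ∀ z, FreeGroup.IsReduced (pathWord f r l z) := by
  induction l with
  | nil => exact fun z => FreeGroup.IsReduced.nil
  | cons x l ih =>
    intro z
    cases l with
    | nil => exact FreeGroup.IsReduced.singleton
    | cons y l =>
      rw [List.isChain_cons_cons] at hl
      have ih' := ih hl.2 (fun x hx => hsep x (List.mem_cons_of_mem _ hx))
        ((f (t ^ (x.1 : ℤ) * of x.2))⁻¹ * z)
      obtain ⟨e, b⟩ := x
      obtain ⟨e', b'⟩ := y
      have hs := hsep (e, b) List.mem_cons_self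
      have h1 := hl.1
      simp only at hs h1
      simp only [pathWord] at ih' ⊢
      rw [FreeGroup.isReduced_cons_cons]
      refine ⟨?_, ih'⟩
      rcases Int.units_eq_one_or e with rfl | rfl <;>
        rcases Int.units_eq_one_or e' with rfl | rfl
      · simp
      · have hb : b ∉ toSubgroup H K 1 := fun hb => absurd (h1 hb) (by decide)
        intro hh
        exfalso
        obtain ⟨h, hh⟩ := hr _ _ hh
        refine hs hb (h⁻¹ : H) (by simp) ?_
        rw [Units.val_one, zpow_one, map_mul, mul_inv_rev, mul_assoc] at hh
        rw [Subgroup.coe_inv, map_inv, map_inv, ← mul_right_cancel hh, inv_inv]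
      · have hb : b ∉ toSubgroup H K (-1) := fun hb => absurd (h1 hb) (by decide)
        intro hh
        exfalso
        obtain ⟨h, hh⟩ := hr _ _ hh
        refine hs hb (φ h⁻¹ : K) (by simp) ?_
        have h2 : (f t)⁻¹ * ((f (of b))⁻¹ * f t) = f (of h.1) := by
          apply mul_right_cancel (b := z)
          rw [← hh]
          simp [mul_assoc]
        rw [equiv_eq_conj, Subgroup.coe_inv, map_inv, map_mul, map_mul, map_inv, map_inv, ← h2]
        group
      · simp


theorem left_list_prod (f : HNNExtension B H K φ →* G) (r : G → G)
    (F : HNNExtension B H K φ →* FreeGroup G ≀ᵣ G) (hFB : ∀ b, F (of b) = ⟨1, f (of b)⟩)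
    (hFt : F t = ⟨fun z => FreeGroup.of (r ((f t)⁻¹ * z)), f t⟩) (l : List (ℤˣ × B)) (z : G) :
    (F (l.map fun x => t ^ (x.1 : ℤ) * of x.2).prod).left z = FreeGroup.mk (pathWord f r l z) := by
  have hright : ∀ e, (F e).right = f e := fun e =>
    DFunLike.congr_fun (hom_ext (f := RegularWreathProduct.rightHom.comp F) (g := f)
      (by ext b; simp [hFB]) (by simp [hFt])) e
  induction l generalizing z with
  | nil => simp [pathWord, FreeGroup.one_eq_mk]
  | cons x l ih =>
    obtain ⟨e, b⟩ := x
    rw [List.map_cons, List.prod_cons, map_mul, RegularWreathProduct.mul_left]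
    simp only [Pi.mul_apply, hright, ih, pathWord]
    rw [← List.singleton_append, ← FreeGroup.mul_mk]
    congr 1
    rcases Int.units_eq_one_or e with rfl | rfl
    · simp [hFB, hFt, FreeGroup.of]
    · simp [hFB, hFt, FreeGroup.of, FreeGroup.inv_mk, FreeGroup.invRev]

end HNNExtension

namespace IsRootClass
open HNNExtension NormalWord

/-- A reduced word with stable letters survives in a quotient belonging to a root class whenever
some homomorphism into a group of the class separates its coefficients from the associated
subgroups. -/
theorem exists_hom_reducedWord {C : GroupClass.{u}} (hC : IsRootClass C) (hquot : QuotClosed C)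
    {B G : Type u} [Group B] [Group G] {H K : Subgroup B} {φ : H ≃* K}
    (f : HNNExtension B H K φ →* G) (hG : C G) (w : ReducedWord B H K) (hw : w.toList ≠ [])
    (hsep : ∀ x ∈ w.toList, x.2 ∉ toSubgroup H K x.1 →
      ∀ a ∈ toSubgroup H K x.1, f (of x.2) ≠ f (of a)) :
    ∃ (X : Type u) (_ : Group X) (g : HNNExtension B H K φ →* X), C X ∧ g (w.prod φ) ≠ 1 := by
  by_cases hfw : f (w.prod φ) = 1
  swap
  · exact ⟨G, _, f, hG, hfw⟩
  obtain ⟨r, hr, hr'⟩ := exists_coset_label ((f.comp of).comp H.subtype)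
  simp only [MonoidHom.comp_apply, Subgroup.subtype_apply] at hr hr'
  obtain ⟨F, hFB, hFt⟩ := exists_hom_of_cocycle f (fun _ _ => (1 : FreeGroup G))
    (fun _ _ _ => (mul_one 1).symm) (fun y => FreeGroup.of (r y)) (fun h y => by
      rw [hr, mul_one, one_mul])
  have hright : ∀ e, (F e).right = f e := fun e =>
    DFunLike.congr_fun (hom_ext (f := RegularWreathProduct.rightHom.comp F) (g := f)
      (by ext b; simp [hFB]) (by simp [hFt])) e
  have hred := isReduced_pathWord f r hr' w.toList w.chain hsep
  have hne : ∀ z, pathWord f r w.toList z ≠ [] := fun z => by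
    cases h : w.toList with
    | nil => exact absurd h hw
    | cons x l => simp [pathWord]
  let z0 := (f (of w.head))⁻¹
  obtain ⟨X, _, g, hX, hg⟩ := hC.exists_freeGroup_hom hquot (hred z0) (hne z0)
  let θ : f.ker →* X :=
    { toFun := fun n => g ((F n).left 1)
      map_one' := by simp
      map_mul' := fun a b => by
        have : f a = 1 := a.2
        simp [hright, this] }
  obtain ⟨Q, _, F', hQ, hF'⟩ := hC.exists_hom_of_ker_hom f θ hG hX
  refine ⟨Q, _, F', hQ, fun h => hg ?_⟩
  obtain ⟨h1, h2⟩ := hF' _ h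
  have h3 := left_list_prod f r F hFB hFt w.toList z0
  rw [← h3, ← h2]
  simp only [θ, MonoidHom.coe_mk, OneHom.coe_mk, ReducedWord.prod, map_mul]
  simp [hFB, z0]

end IsRootClass

namespace Subgroup

variable {B X : Type*} [Group B] [Group X]

theorem exists_mul_of_mem_sup_normal {Y N : Subgroup B} [N.Normal] {d : B} (hd : d ∈ Y ⊔ N) :
    ∃ y : Y, ∃ n ∈ N, d = y * n := by
  rw [← SetLike.mem_coe, mul_normal] at hd
  obtain ⟨y, hy, n, hn, rfl⟩ := hd
  exact ⟨⟨y, hy⟩, n, hn, rfl⟩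

theorem exists_extend_sup (Y N : Subgroup B) [N.Normal] (i : Y →* X)
    (hi : ∀ y : Y, (y : B) ∈ N → i y = 1) :
    ∃ ρ : B → X, (∀ d ∈ Y ⊔ N, ∀ d' ∈ Y ⊔ N, ρ (d * d') = ρ d * ρ d') ∧
      ∀ (y : Y), ∀ n ∈ N, ρ (y * n) = i y := by
  have h : ∀ d : B, ∃ x : X, ∀ y : Y, ∀ n ∈ N, d = y * n → x = i y := by
    intro d
    by_cases hd : d ∈ Y ⊔ N
    · obtain ⟨y, n, hn, rfl⟩ := exists_mul_of_mem_sup_normal hd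
      refine ⟨i y, fun y' n' hn' h => ?_⟩
      have : i (y'⁻¹ * y) = 1 := hi _ (by
        have h2 : ((y'⁻¹ * y : Y) : B) = n' * n⁻¹ := by
          rw [coe_mul, coe_inv, eq_mul_inv_iff_mul_eq, mul_assoc, h, inv_mul_cancel_left]
        rw [h2]
        exact N.mul_mem hn' (N.inv_mem hn))
      rw [map_mul, map_inv, inv_mul_eq_one] at this
      exact this.symm
    · refine ⟨1, fun y n hn h => absurd ?_ hd⟩
      rw [h]
      exact mul_mem_sup y.2 hn
  choose ρ hρ using h
  refine ⟨ρ, fun d hd d' hd' => ?_, fun y n hn => hρ _ y n hn rfl⟩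
  obtain ⟨y, n, hn, rfl⟩ := exists_mul_of_mem_sup_normal hd
  obtain ⟨y', n', hn', rfl⟩ := exists_mul_of_mem_sup_normal hd'
  rw [hρ _ y n hn rfl, hρ _ y' n' hn' rfl, ← map_mul]
  refine hρ _ (y * y') ((y' : B)⁻¹ * n * y' * n') (N.mul_mem ?_ hn') ?_
  · simpa using ‹N.Normal›.conj_mem n hn (y' : B)⁻¹
  · rw [coe_mul]; group

section extend

variable {Y N : Subgroup B} {i : Y →* X} {ρ : B → X}
  (h : ∀ (y : Y), ∀ n ∈ N, ρ (y * n) = i y)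

include h

theorem extend_apply (y : Y) : ρ y = i y := by
  rw [← h y 1 N.one_mem, mul_one]

theorem extend_eq_one {n : B} (hn : n ∈ N) : ρ n = 1 := by
  have := h 1 n hn
  rwa [coe_one, one_mul, map_one] at this

theorem extend_eq_one_iff [N.Normal] {d : B} (hd : d ∈ Y ⊔ N) :
    ρ d = 1 ↔ d ∈ i.ker.map Y.subtype ⊔ N := by
  constructor
  · intro h1
    obtain ⟨y, n, hn, rfl⟩ := exists_mul_of_mem_sup_normal hd
    rw [h y n hn] at h1
    exact mul_mem_sup ⟨y, h1, rfl⟩ hn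
  · intro h1
    obtain ⟨⟨_, y, hy, rfl⟩, n, hn, rfl⟩ := exists_mul_of_mem_sup_normal h1
    exact (h y n hn).trans hy

theorem extend_conj [Y.Normal] [N.Normal] {b : B} {x : X}
    (hx : ∀ y : Y, i (MulAut.conjNormal b y) = x * i y * x⁻¹) {d : B} (hd : d ∈ Y ⊔ N) :
    ρ (b * d * b⁻¹) = x * ρ d * x⁻¹ := by
  obtain ⟨y, n, hn, rfl⟩ := exists_mul_of_mem_sup_normal hd
  rw [h y n hn, ← hx, ← h _ _ (‹N.Normal›.conj_mem n hn b), MulAut.conjNormal_apply]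
  congr 1
  group

end extend

/-- The automorphisms of a quotient induced by automorphisms preserving the normal subgroup. -/
def quotientAut {Y : Type*} [Group Y] (M : Subgroup Y) [M.Normal] (U : Subgroup (MulAut Y))
    (hU : ∀ a ∈ U, ∀ m ∈ M, a m ∈ M) : U →* MulAut (Y ⧸ M) where
  toFun a := QuotientGroup.congr M M a.1 (by
    refine le_antisymm ?_ fun m hm => ?_
    · rintro _ ⟨m, hm, rfl⟩
      exact hU _ a.2 _ hm
    · exact ⟨_, hU _ (U.inv_mem a.2) _ hm, MulAut.apply_inv_self _ _ _⟩)
  map_one' := by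
    ext x
    obtain ⟨x, rfl⟩ := QuotientGroup.mk_surjective x
    rfl
  map_mul' a b := by
    ext x
    obtain ⟨x, rfl⟩ := QuotientGroup.mk_surjective x
    rfl

end Subgroup

namespace IsRootClass

variable {C : GroupClass.{u}} (hC : IsRootClass C) (hquot : QuotClosed C)
include hC hquot

theorem of_sup_eq_top {U : Type u} [Group U] (A D : Subgroup U) [A.Normal] (h : A ⊔ D = ⊤)
    (hA : C A) (hD : C D) : C U := by
  have hs : Function.Surjective ((QuotientGroup.mk' A).comp D.subtype) := by
    intro x
    obtain ⟨x, rfl⟩ := QuotientGroup.mk_surjective x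
    have hx : x ∈ D ⊔ A := by rw [sup_comm, h]; trivial
    obtain ⟨d, a, ha, rfl⟩ := exists_mul_of_mem_sup_normal hx
    exact ⟨d, by simpa [QuotientGroup.eq] using ha⟩
  refine hC.of_ker (QuotientGroup.mk' A) (hC.of_surjective hquot _ hs hD) ?_
  rwa [QuotientGroup.ker_mk']

/-- Automorphism groups generated by two subgroups, one of which is normal in the join, are
realized modulo an invariant subgroup by inner automorphisms of a group of the class. -/
theorem exists_holomorph {Y X₁ X₂ G₁ G₂ : Type u} [Group Y] [Group X₁] [Group X₂] [Group G₁]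
    [Group G₂] (M : Subgroup Y) [M.Normal] (hM : C (Y ⧸ M)) (κ₁ : X₁ →* MulAut Y)
    (κ₂ : X₂ →* MulAut Y) (q₁ : X₁ →* G₁) (q₂ : X₂ →* G₂) (h₁ : C G₁) (h₂ : C G₂)
    (hκ₁ : ∀ x, ∀ m ∈ M, κ₁ x m ∈ M) (hκ₂ : ∀ x, ∀ m ∈ M, κ₂ x m ∈ M)
    (hq₁ : ∀ x, q₁ x = 1 → ∀ y, (κ₁ x y)⁻¹ * y ∈ M) (hq₂ : ∀ x, q₂ x = 1 → ∀ y, (κ₂ x y)⁻¹ * y ∈ M)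
    (hU : NormalIn κ₁.range (κ₁.range ⊔ κ₂.range) ∨ NormalIn κ₂.range (κ₁.range ⊔ κ₂.range) ∨
      C ↥(κ₁.range ⊔ κ₂.range)) :
    ∃ (X : Type u) (_ : Group X) (i : Y →* X), C X ∧ i.ker = M ∧
      ∀ a ∈ κ₁.range ⊔ κ₂.range, ∃ x, ∀ y, i (a y) = x * i y * x⁻¹ := by
  set U := κ₁.range ⊔ κ₂.range with hUdef
  have hUM : ∀ a ∈ U, ∀ m ∈ M, a m ∈ M := by
    let S : Subgroup (MulAut Y) :=
      { carrier := {a | ∀ m, a m ∈ M ↔ m ∈ M}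
        one_mem' := fun m => Iff.rfl
        mul_mem' := fun ha hb m => (ha _).trans (hb m)
        inv_mem' := fun {a} ha m => by rw [← ha (a⁻¹ m), MulAut.apply_inv_self] }
    have hS : ∀ (X : Type u) [Group X] (κ : X →* MulAut Y), (∀ x, ∀ m ∈ M, κ x m ∈ M) →
        κ.range ≤ S := by
      rintro X _ κ h _ ⟨x, rfl⟩ m
      refine ⟨fun hm => ?_, h x m⟩
      have := h x⁻¹ _ hm
      rwa [map_inv, MulAut.inv_apply_self] at this
    exact fun a ha m => ((sup_le (hS _ κ₁ hκ₁) (hS _ κ₂ hκ₂)) ha m).2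
  let θ := quotientAut M U hUM
  let j₁ : X₁ →* U := κ₁.codRestrict U fun x => mem_sup_left ⟨x, rfl⟩
  let j₂ : X₂ →* U := κ₂.codRestrict U fun x => mem_sup_right ⟨x, rfl⟩
  have hj₁ : j₁.range = κ₁.range.subgroupOf U := by
    ext a
    simp [j₁, mem_subgroupOf, MonoidHom.mem_range, Subtype.ext_iff]
  have hj₂ : j₂.range = κ₂.range.subgroupOf U := by
    ext a
    simp [j₂, mem_subgroupOf, MonoidHom.mem_range, Subtype.ext_iff]
  have hj : j₁.range ⊔ j₂.range = ⊤ := by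
    rw [hj₁, hj₂, ← subgroupOf_sup le_sup_left le_sup_right, subgroupOf_self]
  have hmap : ∀ (X : Type u) [Group X] (j : X →* U),
      (θ.rangeRestrict.comp j).range = j.range.map θ.rangeRestrict := fun X _ j =>
    MonoidHom.range_comp _ _
  have hW₁ : C (θ.rangeRestrict.comp j₁).range := by
    refine hC.of_hom_le hquot q₁ h₁ _ (MonoidHom.rangeRestrict_surjective _) fun x hx => ?_
    refine Subtype.ext (Subtype.ext (MulEquiv.ext fun y => ?_))
    obtain ⟨y, rfl⟩ := QuotientGroup.mk_surjective y
    exact QuotientGroup.eq.2 (hq₁ x hx y)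
  have hW₂ : C (θ.rangeRestrict.comp j₂).range := by
    refine hC.of_hom_le hquot q₂ h₂ _ (MonoidHom.rangeRestrict_surjective _) fun x hx => ?_
    refine Subtype.ext (Subtype.ext (MulEquiv.ext fun y => ?_))
    obtain ⟨y, rfl⟩ := QuotientGroup.mk_surjective y
    exact QuotientGroup.eq.2 (hq₂ x hx y)
  have htop : (θ.rangeRestrict.comp j₁).range ⊔ (θ.rangeRestrict.comp j₂).range = ⊤ := by
    rw [hmap, hmap, ← Subgroup.map_sup, hj, ← MonoidHom.range_eq_map,
      MonoidHom.range_eq_top.2 θ.rangeRestrict_surjective]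
  have hW : C θ.range := by
    rcases hU with hU | hU | hU
    · have : (θ.rangeRestrict.comp j₁).range.Normal := by
        rw [hmap, hj₁]
        exact Subgroup.Normal.map hU _ θ.rangeRestrict_surjective
      exact hC.of_sup_eq_top hquot _ _ htop hW₁ hW₂
    · have : (θ.rangeRestrict.comp j₂).range.Normal := by
        rw [hmap, hj₂]
        exact Subgroup.Normal.map hU _ θ.rangeRestrict_surjective
      exact hC.of_sup_eq_top hquot _ _ (by rwa [sup_comm]) hW₂ hW₁
    · exact hC.of_surjective hquot _ θ.rangeRestrict_surjective hU
  let i : (Y ⧸ M) →* (Y ⧸ M) ⋊[θ.range.subtype] θ.range := SemidirectProduct.inl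
  refine ⟨_, _, i.comp (QuotientGroup.mk' M), ?_, ?_, fun a ha => ?_⟩
  · refine hC.of_ker SemidirectProduct.rightHom hW ?_
    rw [← SemidirectProduct.range_inl_eq_ker_rightHom]
    exact hC.of_surjective hquot _ (MonoidHom.rangeRestrict_surjective _) hM
  · rw [← MonoidHom.comap_ker, (MonoidHom.ker_eq_bot_iff _).2 SemidirectProduct.inl_injective,
      MonoidHom.comap_bot, QuotientGroup.ker_mk']
  · refine ⟨SemidirectProduct.inr (θ.rangeRestrict ⟨a, ha⟩), fun y => ?_⟩
    rw [← map_inv]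
    exact SemidirectProduct.inl_aut (φ := θ.range.subtype) (θ.rangeRestrict ⟨a, ha⟩)
      (QuotientGroup.mk' M y)

end IsRootClass

theorem autOf_eq_range {B : Type u} [Group B] (Y : Subgroup B) [Y.Normal] :
    autOf B Y = (MulAut.conjNormal (H := Y)).range := by
  ext α
  constructor
  · rintro ⟨x, hx⟩
    exact ⟨x, MulEquiv.ext fun y => Subtype.ext ((MulAut.conjNormal_apply x y).trans (hx y).symm)⟩
  · rintro ⟨x, rfl⟩
    exact ⟨x, MulAut.conjNormal_apply x⟩

theorem frakK_eq_range {B : Type u} [Group B] (H K : Subgroup B) [K.Normal] (φ : H ≃* K) :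
    frakK H K φ = ((autConjHom φ).comp (MulAut.conjNormal (H := K))).range := by
  rw [frakK, autOf_eq_range, MonoidHom.range_comp]

namespace HNNExtension

variable {C : GroupClass.{u}} (hC : IsRootClass C) (hquot : QuotClosed C) {B : Type u} [Group B]
  {H K : Subgroup B} {φ : H ≃* K} [H.Normal] [K.Normal]
  {Q T : Subgroup B} [Q.Normal]
include hC hquot

/-- A quotient of the base group whose kernel meets `HK` in a subgroup of `L` extends to the
HNN-extension at the cost of shrinking to the quotient by `LQ`. -/
theorem exists_hom_inf_sup (hT : T ≤ H ⊓ K) (hQT : Q ⊓ (H ⊔ K) ≤ T)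
    (hφL : ∀ h : H, (h : B) ∈ H ⊓ K ↔ (φ h : B) ∈ H ⊓ K) (hQ : C (B ⧸ Q))
    (hHL : C (H ⧸ (H ⊓ K).subgroupOf H)) (hdag : CondDag C H K φ) :
    ∃ (G : Type u) (_ : Group G) (F : HNNExtension B H K φ →* G), C G ∧
      ∀ b, F (of b) = 1 ↔ b ∈ (H ⊓ K) ⊔ Q := by
  have hcomm : ∀ b ∈ Q, ∀ y ∈ H ⊔ K, b * y * b⁻¹ * y⁻¹ ∈ T := by
    intro b hb y hy
    refine hQT ⟨?_, ?_⟩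
    · rw [mul_assoc, mul_assoc]
      refine Q.mul_mem hb ?_
      rw [← mul_assoc]
      exact ‹Q.Normal›.conj_mem _ (Q.inv_mem hb) _
    · exact (H ⊔ K).mul_mem ((inferInstance : (H ⊔ K).Normal).conj_mem y hy b)
        ((H ⊔ K).inv_mem hy)
  have hcomm' : ∀ b ∈ Q, ∀ y ∈ H ⊔ K, (b * y * b⁻¹)⁻¹ * y ∈ H ⊓ K := by
    intro b hb y hy
    have := (inferInstance : (H ⊓ K).Normal).conj_mem _
      ((H ⊓ K).inv_mem (hT (hcomm b hb y hy))) y⁻¹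
    convert this using 1
    group
  obtain ⟨X, _, i, hX, hi, hi'⟩ := hC.exists_holomorph hquot ((H ⊓ K).subgroupOf H) hHL
    (MulAut.conjNormal (H := H)) ((autConjHom φ).comp (MulAut.conjNormal (H := K)))
    (QuotientGroup.mk' Q) (QuotientGroup.mk' Q) hQ hQ
    (fun x m hm => by
      rw [mem_subgroupOf, MulAut.conjNormal_apply]
      exact (inferInstance : (H ⊓ K).Normal).conj_mem _ hm x)
    (fun x m hm => by
      rw [mem_subgroupOf, hφL]
      have h1 : φ (((autConjHom φ).comp (MulAut.conjNormal (H := K))) x m) =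
        MulAut.conjNormal x (φ m) := φ.apply_symm_apply _
      rw [h1, MulAut.conjNormal_apply]
      exact (inferInstance : (H ⊓ K).Normal).conj_mem _ ((hφL m).1 hm) x)
    (fun x hx y => by
      have hx' : x ∈ Q := by simpa using hx
      rw [mem_subgroupOf]
      exact hcomm' x hx' y (mem_sup_left y.2))
    (fun x hx y => by
      have hx' : x ∈ Q := by simpa using hx
      rw [mem_subgroupOf, hφL]
      have h1 : φ ((((autConjHom φ).comp (MulAut.conjNormal (H := K))) x y)⁻¹ * y) =
          (MulAut.conjNormal x (φ y))⁻¹ * φ y := by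
        rw [map_mul, map_inv]
        congr 2
        exact φ.apply_symm_apply _
      rw [h1]
      exact hcomm' x hx' (φ y) (mem_sup_right (φ y).2))
    (by
      rw [← autOf_eq_range, ← frakK_eq_range]
      exact hdag)
  rw [← autOf_eq_range, ← frakK_eq_range] at hi'
  have hik : ∀ h : H, i h = 1 ↔ (h : B) ∈ K := fun h => by
    rw [← MonoidHom.mem_ker, hi, mem_subgroupOf]
    exact ⟨fun h => h.2, fun hk => ⟨h.2, hk⟩⟩
  obtain ⟨ρ₁, hρ₁, hρ₁'⟩ := exists_extend_sup H (K ⊔ Q) i fun h hh => by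
    obtain ⟨k, q, hq, hh⟩ := exists_mul_of_mem_sup_normal hh
    have h1 : q ∈ K := by
      refine (hT (hQT ⟨hq, ?_⟩)).2
      rw [← inv_mul_eq_iff_eq_mul.2 hh]
      exact (H ⊔ K).mul_mem (mem_sup_right (K.inv_mem k.2)) (mem_sup_left h.2)
    rw [hik, hh]
    exact K.mul_mem k.2 h1
  obtain ⟨ρ₂, hρ₂, hρ₂'⟩ := exists_extend_sup K (H ⊔ Q) (i.comp φ.symm.toMonoidHom) fun k hk => by
    obtain ⟨h, q, hq, hh⟩ := exists_mul_of_mem_sup_normal hk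
    have h1 : q ∈ H := by
      refine (hT (hQT ⟨hq, ?_⟩)).1
      rw [← inv_mul_eq_iff_eq_mul.2 hh]
      exact (H ⊔ K).mul_mem (mem_sup_left (H.inv_mem h.2)) (mem_sup_right k.2)
    have h2 : ((φ.symm k : H) : B) ∈ H ⊓ K := by
      rw [hφL, φ.apply_symm_apply]
      exact ⟨hh ▸ H.mul_mem h.2 h1, k.2⟩
    exact (hik _).2 h2.2
  obtain ⟨P, _, hP, hPn⟩ := hC.2.1
  obtain ⟨g, hg⟩ := exists_ne (1 : P)
  let D := H ⊔ (K ⊔ Q)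
  have hD : D = K ⊔ (H ⊔ Q) := sup_left_comm _ _ _
  let f : HNNExtension B H K φ →* B ⧸ D := lift (QuotientGroup.mk' D) 1 fun h => by
    rw [one_mul, mul_one]
    have h1 : (QuotientGroup.mk' D) h = 1 := by
      simpa using (mem_sup_left h.2 : (h : B) ∈ D)
    have h2 : (QuotientGroup.mk' D) (φ h) = 1 := by
      simpa using (mem_sup_right (mem_sup_left (φ h).2) : (φ h : B) ∈ D)
    rw [h1, h2]
  have hf : ∀ b, f (of b) = 1 ↔ b ∈ D := fun b => by simp [f]
  classical
  let pr : X → X → P → X := fun a b p => if p = 1 then a else if p = g then b else 1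
  have hpr1 : ∀ a b, pr a b 1 = a := fun a b => by simp [pr]
  have hprg : ∀ a b, pr a b g = b := fun a b => by simp [pr, hg]
  have hprm : ∀ a b a' b', pr a b * pr a' b' = pr (a * a') (b * b') := fun a b a' b' => by
    ext p
    simp only [pr, Pi.mul_apply]
    split_ifs <;> simp
  have hpri : ∀ a b, (pr a b)⁻¹ = pr a⁻¹ b⁻¹ := fun a b => by
    ext p
    simp only [pr, Pi.inv_apply]
    split_ifs <;> simp
  let ρ : B → X ≀ᵣ P := fun d => ⟨pr (ρ₁ d) (ρ₂ d), 1⟩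
  obtain ⟨F, hF⟩ := exists_hom_wreath f D hf ρ
    (fun d hd d' hd' => by
      refine RegularWreathProduct.ext ?_ (by simp [ρ])
      rw [RegularWreathProduct.mul_left]
      simp [ρ, hρ₁ d hd d' hd', hρ₂ d (hD ▸ hd) d' (hD ▸ hd'), ← hprm])
    (fun b => by
      obtain ⟨x, hx⟩ := hi' (MulAut.conjNormal b) (mem_sup_left (by
        rw [autOf_eq_range]; exact ⟨b, rfl⟩))
      obtain ⟨y, hy⟩ := hi' (autConjHom φ (MulAut.conjNormal b)) (mem_sup_right (by
        rw [frakK_eq_range]; exact ⟨b, rfl⟩))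
      refine ⟨⟨pr x y, 1⟩, fun d hd => ?_⟩
      refine RegularWreathProduct.ext ?_ (by simp [ρ])
      have e1 := extend_conj hρ₁' hx hd
      have e2 := extend_conj hρ₂' (b := b) (x := y) (fun k => by
        have := hy (φ.symm k)
        simpa [autConjHom] using this) (hD ▸ hd)
      simp only [ρ, e1, e2]
      rw [← hprm, ← hprm, ← hpri]
      ext p
      simp)
    ⟨1, g⟩
    (fun h _ => by
      have e1 : ρ₁ h = i h := extend_apply hρ₁' h
      have e2 : ρ₂ h = 1 := extend_eq_one hρ₂' (mem_sup_left h.2)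
      have e3 : ρ₂ (φ h) = i h := (extend_apply hρ₂' (φ h)).trans (by simp)
      have e4 : ρ₁ (φ h) = 1 := extend_eq_one hρ₁' (mem_sup_left (φ h).2)
      refine RegularWreathProduct.ext ?_ (by simp [ρ])
      simp only [ρ, e1, e2, e3, e4]
      ext p
      have : g⁻¹ * p = 1 ↔ p = g := by rw [inv_mul_eq_one, eq_comm]
      by_cases hp : p = g
      · subst hp; simp [hpr1, hprg]
      · simp [pr, hp, this])
  refine ⟨_, _, F, hC.wreath (hC.wreath hX hP) ?_, fun b => ?_⟩
  · refine hC.of_hom_le hquot (QuotientGroup.mk' Q) hQ (QuotientGroup.mk' D)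
      (QuotientGroup.mk'_surjective _) fun b hb => ?_
    have hb : b ∈ Q := by simpa using hb
    simpa using (mem_sup_right (mem_sup_right hb) : b ∈ D)
  · rw [hF]
    have hρ1 : ρ b = 1 ↔ ρ₁ b = 1 ∧ ρ₂ b = 1 := by
      constructor
      · intro h
        have h' : pr (ρ₁ b) (ρ₂ b) = 1 := congrArg RegularWreathProduct.left h
        exact ⟨(hpr1 _ _).symm.trans (congrFun h' 1), (hprg _ _).symm.trans (congrFun h' g)⟩
      · rintro ⟨h1, h2⟩
        refine RegularWreathProduct.ext ?_ rfl
        ext p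
        simp [ρ, h1, h2, pr]
    rw [hρ1]
    constructor
    · rintro ⟨hb, h1, h2⟩
      have h1' := (extend_eq_one_iff hρ₁' hb).1 h1
      have h2' := (extend_eq_one_iff hρ₂' (hD ▸ hb)).1 h2
      have h3 : b ∈ K ⊔ Q := by
        refine (sup_le ?_ le_rfl : i.ker.map H.subtype ⊔ (K ⊔ Q) ≤ K ⊔ Q) h1'
        rintro _ ⟨y, hy, rfl⟩
        exact mem_sup_left ((hik y).1 hy)
      have h4 : b ∈ H ⊔ Q := by
        refine (sup_le ?_ le_rfl :
          (i.comp φ.symm.toMonoidHom).ker.map K.subtype ⊔ (H ⊔ Q) ≤ H ⊔ Q) h2'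
        rintro _ ⟨y, hy, rfl⟩
        refine mem_sup_left ?_
        have h5 : ((φ.symm y : H) : B) ∈ H ⊓ K := ⟨(φ.symm y).2, (hik _).1 hy⟩
        rw [hφL, φ.apply_symm_apply] at h5
        exact h5.1
      obtain ⟨k, q, hq, rfl⟩ := exists_mul_of_mem_sup_normal h3
      obtain ⟨h, q', hq', hh⟩ := exists_mul_of_mem_sup_normal h4
      have h6 : (k : B)⁻¹ * h = q * q'⁻¹ := by
        rw [inv_mul_eq_iff_eq_mul, ← mul_assoc, hh, mul_inv_cancel_right]
      have h7 : (k : B)⁻¹ * h ∈ H := (hT (hQT ⟨by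
        rw [h6]; exact Q.mul_mem hq (Q.inv_mem hq'),
        (H ⊔ K).mul_mem (mem_sup_right (K.inv_mem k.2)) (mem_sup_left h.2)⟩)).1
      have h8 : (k : B) ∈ H := by
        have := H.mul_mem h.2 (H.inv_mem h7)
        simpa using this
      exact mul_mem_sup ⟨h8, k.2⟩ hq
    · intro hb
      obtain ⟨l, q, hq, rfl⟩ := exists_mul_of_mem_sup_normal hb
      have hl := l.2
      have hlD : (l : B) * q ∈ D := D.mul_mem (mem_sup_left l.2.1) (mem_sup_right (mem_sup_right hq))
      refine ⟨hlD, (extend_eq_one_iff hρ₁' hlD).2 ?_,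
        (extend_eq_one_iff hρ₂' (hD ▸ hlD)).2 ?_⟩
      · exact mem_sup_right (mul_mem_sup hl.2 hq)
      · exact mem_sup_right (mul_mem_sup hl.1 hq)

/-- A quotient of the base group whose kernel meets `HK` in a `φ`-invariant subgroup of `L`
extends to the HNN-extension. -/
theorem exists_hom_ker_of [T.Normal] (hT : T ≤ H ⊓ K) (hQT : Q ⊓ (H ⊔ K) = T)
    {ψ : MulAut ↥(H ⊓ K)} (hψ : IsRestrictionToL H K φ ψ)
    (hφT : ∀ h : H, (h : B) ∈ T ↔ (φ h : B) ∈ T) (hQ : C (B ⧸ Q))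
    (hHL : C (H ⧸ (H ⊓ K).subgroupOf H)) (hdag : CondDag C H K φ) (hddag : CondDDag C H K ψ)
    (hF : C (zpowers ψ)) :
    ∃ (G : Type u) (_ : Group G) (F : HNNExtension B H K φ →* G), C G ∧
      ∀ b, F (of b) = 1 ↔ b ∈ Q := by
  have hφL : ∀ h : H, (h : B) ∈ H ⊓ K ↔ (φ h : B) ∈ H ⊓ K := by
    refine fun h => ⟨fun hh => ?_, fun hh => ?_⟩
    · rw [← hψ ⟨h, hh⟩]
      exact (ψ ⟨h, hh⟩).2
    · have h1 := hψ (ψ⁻¹ ⟨φ h, hh⟩)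
      rw [MulAut.apply_inv_self] at h1
      have h2 := φ.injective (Subtype.ext h1)
      rw [h2]
      exact (ψ⁻¹ ⟨φ h, hh⟩).2
  have hTQ : T ≤ Q := hQT ▸ inf_le_left
  obtain ⟨G, _, f, hG, hf⟩ := exists_hom_inf_sup hC hquot hT hQT.le hφL hQ hHL hdag
  have hLT : C (↥(H ⊓ K) ⧸ T.subgroupOf (H ⊓ K)) := by
    refine hC.of_hom_le hquot ((QuotientGroup.mk' Q).comp (H ⊓ K).subtype) hQ
      (QuotientGroup.mk' _) (QuotientGroup.mk'_surjective _) fun l hl => ?_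
    have hl : (l : B) ∈ Q := by simpa using hl
    rw [QuotientGroup.mk'_apply, QuotientGroup.eq_one_iff, mem_subgroupOf, ← hQT]
    exact ⟨hl, mem_sup_left l.2.1⟩
  obtain ⟨X, _, i, hX, hi, hi'⟩ := hC.exists_holomorph hquot (T.subgroupOf (H ⊓ K)) hLT
    (MulAut.conjNormal (H := H ⊓ K)) (zpowers ψ).subtype
    (QuotientGroup.mk' Q) (MonoidHom.id _) hQ hF
    (fun x m hm => by
      rw [mem_subgroupOf, MulAut.conjNormal_apply]
      exact ‹T.Normal›.conj_mem _ hm x)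
    (by
      have h1 : ∀ l : ↥(H ⊓ K), (ψ l : B) ∈ T ↔ (l : B) ∈ T := fun l => by
        rw [hψ, ← hφT]
      let S : Subgroup (MulAut ↥(H ⊓ K)) :=
        { carrier := {a | ∀ l, (a l : B) ∈ T ↔ (l : B) ∈ T}
          one_mem' := fun m => Iff.rfl
          mul_mem' := fun ha hb m => (ha _).trans (hb m)
          inv_mem' := fun {a} ha m => by rw [← ha (a⁻¹ m), MulAut.apply_inv_self] }
      have h2 : zpowers ψ ≤ S := by rwa [zpowers_le]
      exact fun x m hm => (h2 x.2 m).2 hm)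
    (fun x hx y => by
      have hx' : x ∈ Q := by simpa using hx
      rw [mem_subgroupOf, ← hQT]
      refine ⟨?_, mem_sup_left (((MulAut.conjNormal x y)⁻¹ * y).2.1)⟩
      rw [coe_mul, coe_inv, MulAut.conjNormal_apply]
      have := Q.mul_mem hx' (‹Q.Normal›.conj_mem _ (Q.inv_mem hx') (y : B)⁻¹)
      have h3 : (x * (y : B) * x⁻¹)⁻¹ * y = x * ((y : B)⁻¹ * x⁻¹ * (y : B)⁻¹⁻¹) := by group
      rwa [h3])
    (fun x hx y => by
      have hx' : x = 1 := hx
      subst hx'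
      simp)
    (by
      rw [← autOf_eq_range, range_subtype]
      exact hddag)
  rw [← autOf_eq_range, range_subtype] at hi'
  have hiT : ∀ l : ↥(H ⊓ K), i l = 1 ↔ (l : B) ∈ T := fun l => by
    rw [← MonoidHom.mem_ker, hi, mem_subgroupOf]
  obtain ⟨ρ, hρ, hρ'⟩ := exists_extend_sup (H ⊓ K) Q i fun l hl => by
    rw [hiT, ← hQT]
    exact ⟨hl, mem_sup_left l.2.1⟩
  obtain ⟨xt, hxt⟩ := hi' ψ (mem_sup_right (mem_zpowers ψ))
  obtain ⟨F, hF'⟩ := exists_hom_wreath f ((H ⊓ K) ⊔ Q) hf ρ hρ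
    (fun b => by
      obtain ⟨x, hx⟩ := hi' (MulAut.conjNormal b) (mem_sup_left (by
        rw [autOf_eq_range]; exact ⟨b, rfl⟩))
      exact ⟨x, fun d hd => extend_conj hρ' hx hd⟩)
    xt (fun h hh => by
      have hh' : (h : B) ∈ H ⊓ K := by
        obtain ⟨l, q, hq, hlq⟩ := exists_mul_of_mem_sup_normal hh
        have h1 : q ∈ T := by
          rw [← hQT]
          refine ⟨hq, mem_sup_left ?_⟩
          rw [← inv_mul_eq_iff_eq_mul.2 hlq]
          exact H.mul_mem (H.inv_mem l.2.1) h.2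
        rw [hlq]
        exact (H ⊓ K).mul_mem l.2 (hT h1)
      have h2 := hψ ⟨h, hh'⟩
      have h3 := extend_apply hρ' (ψ ⟨h, hh'⟩)
      have h4 := extend_apply hρ' ⟨(h : B), hh'⟩
      rw [h2, hxt, ← h4] at h3
      exact h3)
  refine ⟨_, _, F, hC.wreath hX hG, fun b => ?_⟩
  rw [hF']
  constructor
  · rintro ⟨hb, h1⟩
    rw [extend_eq_one_iff hρ' hb, hi] at h1
    refine (sup_le ?_ le_rfl : (T.subgroupOf (H ⊓ K)).map (H ⊓ K).subtype ⊔ Q ≤ Q) h1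
    rintro _ ⟨y, hy, rfl⟩
    exact hTQ hy
  · exact fun hb => ⟨mem_sup_right hb, extend_eq_one hρ' hb⟩

end HNNExtension

namespace Subgroup

open scoped Pointwise in
theorem exists_mul_of_normalIn {G : Type u} [Group G] {A D : Subgroup G}
    (h : NormalIn A (A ⊔ D) ∨ NormalIn D (A ⊔ D)) {v : G} (hv : v ∈ A ⊔ D) :
    ∃ a ∈ A, ∃ d ∈ D, v = a * d := by
  have h1 : (⟨v, hv⟩ : ↥(A ⊔ D)) ∈ A.subgroupOf (A ⊔ D) ⊔ D.subgroupOf (A ⊔ D) := by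
    rw [← subgroupOf_sup le_sup_left le_sup_right, subgroupOf_self]
    trivial
  have h2 : ((A.subgroupOf (A ⊔ D) ⊔ D.subgroupOf (A ⊔ D) : Subgroup _) : Set ↥(A ⊔ D)) =
      (A.subgroupOf (A ⊔ D) : Set ↥(A ⊔ D)) * (D.subgroupOf (A ⊔ D) : Set ↥(A ⊔ D)) := by
    rcases h with h | h
    · have : (A.subgroupOf (A ⊔ D)).Normal := h
      exact normal_mul _ _
    · have : (D.subgroupOf (A ⊔ D)).Normal := h
      exact mul_normal _ _
  rw [← SetLike.mem_coe, h2] at h1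
  obtain ⟨a, ha, d, hd, had⟩ := h1
  exact ⟨a, ha, d, hd, (congrArg Subtype.val had).symm⟩

end Subgroup

section

variable {C : GroupClass.{u}}

theorem inCStar_of_ker (hC : IsRootClass C) {B G : Type u} [Group B] [Group G] (f : B →* G)
    (hG : C G) : inCStar C B f.ker :=
  ⟨inferInstance, hC.of_injective (QuotientGroup.kerLift f) (QuotientGroup.kerLift_injective f) hG⟩

theorem inCStar.inf (hC : IsRootClass C) {B : Type u} [Group B] {M N : Subgroup B}
    (hM : inCStar C B M) (hN : inCStar C B N) : inCStar C B (M ⊓ N) := by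
  obtain ⟨_, hM⟩ := hM
  obtain ⟨_, hN⟩ := hN
  have := inCStar_of_ker hC ((QuotientGroup.mk' M).prod (QuotientGroup.mk' N)) (hC.prod hM hN)
  rwa [MonoidHom.ker_prod, QuotientGroup.ker_mk', QuotientGroup.ker_mk'] at this

theorem inCStar_top (hC : IsRootClass C) {B : Type u} [Group B] : inCStar C B ⊤ :=
  haveI := QuotientGroup.subsingleton_quotient_top (G := B)
  ⟨inferInstance, hC.of_subsingleton _⟩

theorem inCStar.mono (hC : IsRootClass C) (hquot : QuotClosed C) {B : Type u} [Group B]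
    {M N : Subgroup B} (hN : N.Normal) (h : M ≤ N) (hM : inCStar C B M) : inCStar C B N := by
  obtain ⟨_, hM⟩ := hM
  refine ⟨hN, hC.of_hom_le hquot (QuotientGroup.mk' M) hM (QuotientGroup.mk' N)
    (QuotientGroup.mk'_surjective _) fun x hx => ?_⟩
  have hx : x ∈ M := by simpa using hx
  simpa using h hx

theorem exists_inCStar_list (hC : IsRootClass C) {B : Type u} [Group B] {ι : Type*}
    (P : ι → Subgroup B → Prop) (hP : ∀ x M N, M ≤ N → P x N → P x M) (l : List ι)
    (h : ∀ x ∈ l, ∃ N, inCStar C B N ∧ P x N) : ∃ N, inCStar C B N ∧ ∀ x ∈ l, P x N := by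
  induction l with
  | nil => exact ⟨⊤, inCStar_top hC, by simp⟩
  | cons y l ih =>
    obtain ⟨M, hM, hM'⟩ := ih fun x hx => h x (List.mem_cons_of_mem _ hx)
    obtain ⟨N, hN, hN'⟩ := h y List.mem_cons_self
    refine ⟨N ⊓ M, hN.inf hC hM, fun x hx => ?_⟩
    rcases List.mem_cons.1 hx with rfl | hx
    · exact hP _ _ _ inf_le_left hN'
    · exact hP _ _ _ inf_le_right (hM' x hx)

theorem Residually.exists_inCStar (hC : IsRootClass C) {B : Type u} [Group B] {H : Subgroup B}
    [H.Normal] (h : Residually C (B ⧸ H)) {b : B} (hb : b ∉ H) :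
    ∃ N, inCStar C B N ∧ ∀ a ∈ H, b * a⁻¹ ∉ N := by
  obtain ⟨G, _, f, -, hG, hf⟩ := h b (by simpa using hb)
  refine ⟨(f.comp (QuotientGroup.mk' H)).ker, inCStar_of_ker hC _ hG, fun a ha h => hf ?_⟩
  rw [MonoidHom.mem_ker, map_mul] at h
  have h1 : (f.comp (QuotientGroup.mk' H)) a⁻¹ = 1 := by
    have : QuotientGroup.mk' H a⁻¹ = 1 := by simpa using ha
    rw [MonoidHom.comp_apply, this, map_one]
  rwa [h1, mul_one] at h

theorem residually_of_forall (hC : IsRootClass C) {X : Type u} [Group X]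
    (h : ∀ x : X, x ≠ 1 → ∃ (G : Type u) (_ : Group G) (f : X →* G), C G ∧ f x ≠ 1) :
    Residually C X := by
  intro x hx
  obtain ⟨G, _, f, hG, hf⟩ := h x hx
  exact ⟨_, _, f.rangeRestrict, f.rangeRestrict_surjective,
    hC.of_injective f.range.subtype f.range.subtype_injective hG,
    fun h => hf (congrArg Subtype.val h)⟩

end

namespace IsRootClass

variable {C : GroupClass.{u}} (hC : IsRootClass C)
include hC

theorem exists_hom_forall_aut {Y G : Type u} [Group Y] [Group G] (f : Y →* G) (hG : C G)
    (U : Subgroup (MulAut Y)) (hU : C U) :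
    ∃ (X : Type u) (_ : Group X) (g : Y →* X), C X ∧ ∀ y, g y = 1 → ∀ a ∈ U, f (a y) = 1 := by
  let p : Y ⋊[U.subtype] U →* U := SemidirectProduct.rightHom
  let q : p.ker →* G :=
    { toFun := fun z => f z.1.left
      map_one' := by simp
      map_mul' := fun a b => by
        have : a.1.right = 1 := a.2
        simp [SemidirectProduct.mul_left, this] }
  obtain ⟨X, _, F, hX, hF⟩ := hC.exists_hom_of_ker_hom p q hU hG
  refine ⟨X, _, F.comp SemidirectProduct.inl, hX, fun y hy a ha => ?_⟩
  have h1 := SemidirectProduct.inl_aut (φ := U.subtype) ⟨a, ha⟩ y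
  obtain ⟨h2, h3⟩ := hF (SemidirectProduct.inl (a y)) (by
    have h4 : F (SemidirectProduct.inl y) = 1 := hy
    rw [show a y = (U.subtype ⟨a, ha⟩) y from rfl, h1, map_mul, map_mul, h4, mul_one, ← map_mul,
      ← map_mul, mul_inv_cancel, map_one, map_one])
  exact h3

variable {B : Type u} [Group B] {H K : Subgroup B} {φ : H ≃* K} [H.Normal] [K.Normal]
  {ψ : MulAut ↥(H ⊓ K)} (hψ : IsRestrictionToL H K φ ψ)
include hψ

theorem exists_invariant_le (hddag : CondDDag C H K ψ) (hF : C (zpowers ψ)) {R : Subgroup B}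
    (hR : inCStar C B R) :
    ∃ T : Subgroup B, T.Normal ∧ T ≤ H ⊓ K ∧ T ≤ R ∧
      (∀ h : H, (h : B) ∈ T ↔ (φ h : B) ∈ T) ∧
      ∃ (X : Type u) (_ : Group X) (g : ↥(H ⊓ K) →* X), C X ∧ ∀ l, g l = 1 → (l : B) ∈ T := by
  obtain ⟨hRn, hR⟩ := hR
  have hφL : ∀ h : H, (φ h : B) ∈ H ⊓ K → (h : B) ∈ H ⊓ K := by
    intro h hh
    have h1 := hψ (ψ⁻¹ ⟨φ h, hh⟩)
    rw [MulAut.apply_inv_self] at h1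
    have h2 := φ.injective (Subtype.ext h1)
    rw [h2]
    exact (ψ⁻¹ ⟨φ h, hh⟩).2
  let V := frakV H K ψ
  let T' : Subgroup ↥(H ⊓ K) :=
    { carrier := {l | ∀ v ∈ V, (v l : B) ∈ R}
      one_mem' := fun v _ => by rw [map_one]; exact R.one_mem
      mul_mem' := fun ha hb v hv => by rw [map_mul]; exact R.mul_mem (ha v hv) (hb v hv)
      inv_mem' := fun ha v hv => by rw [map_inv]; exact R.inv_mem (ha v hv) }
  have hT' : ∀ v ∈ V, ∀ l ∈ T', v l ∈ T' := fun v hv l hl w hw => hl (w * v) (V.mul_mem hw hv)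
  have hmem : ∀ (b : B) (hb : b ∈ H ⊓ K), b ∈ T'.map (H ⊓ K).subtype ↔ ⟨b, hb⟩ ∈ T' := by
    intro b hb
    constructor
    · rintro ⟨l, hl, rfl⟩
      exact hl
    · exact fun h => ⟨_, h, rfl⟩
  have hle : T'.map (H ⊓ K).subtype ≤ H ⊓ K := map_subtype_le _
  have hψV : ψ ∈ V := mem_sup_right (mem_zpowers ψ)
  refine ⟨T'.map (H ⊓ K).subtype, ⟨?_⟩, hle, ?_, fun h => ⟨fun hh => ?_, fun hh => ?_⟩, ?_⟩
  · rintro _ ⟨l, hl, rfl⟩ b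
    refine ⟨MulAut.conjNormal b l, hT' _ (mem_sup_left ?_) _ hl, MulAut.conjNormal_apply _ _⟩
    rw [autOf_eq_range]
    exact ⟨b, rfl⟩
  · rintro _ ⟨l, hl, rfl⟩
    exact hl 1 V.one_mem
  · have h1 := (hmem _ (hle hh)).1 hh
    exact ⟨_, hT' _ hψV _ h1, hψ _⟩
  · have h1 := (hmem _ (hle hh)).1 hh
    have h2 := hT' _ (V.inv_mem hψV) _ h1
    have h3 := hφL h (hle hh)
    have h4 : (⟨h, h3⟩ : ↥(H ⊓ K)) = ψ⁻¹ ⟨φ h, hle hh⟩ := by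
      apply ψ.injective
      rw [MulAut.apply_inv_self]
      exact Subtype.ext (hψ _)
    rwa [hmem _ h3, h4]
  · have hLR : ∀ U : Subgroup (MulAut ↥(H ⊓ K)), C U →
        (∀ l : ↥(H ⊓ K), (∀ a ∈ U, (a l : B) ∈ R) → l ∈ T') →
        ∃ (X : Type u) (_ : Group X) (g : ↥(H ⊓ K) →* X), C X ∧
          ∀ l, g l = 1 → (l : B) ∈ T'.map (H ⊓ K).subtype := by
      intro U hU h
      obtain ⟨X, _, g, hX, hg⟩ := hC.exists_hom_forall_aut
        ((QuotientGroup.mk' R).comp (H ⊓ K).subtype) hR U hU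
      exact ⟨X, _, g, hX, fun l hl => ⟨l, h l fun a ha => by simpa using hg l hl a ha, rfl⟩⟩
    have hn : (NormalIn (autOf B (H ⊓ K)) V ∨ NormalIn (zpowers ψ) V) →
        ∀ l : ↥(H ⊓ K), (∀ a ∈ zpowers ψ, (a l : B) ∈ R) → l ∈ T' := by
      intro h l hl v hv
      obtain ⟨a, ha, d, hd, rfl⟩ := exists_mul_of_normalIn h hv
      obtain ⟨x, hx⟩ := ha
      rw [MulAut.mul_apply, hx]
      exact hRn.conj_mem _ (hl d hd) x
    rcases hddag with h | h | h
    · exact hLR _ hF (hn (Or.inl h))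
    · exact hLR _ hF (hn (Or.inr h))
    · exact hLR V h fun l hl => hl

theorem exists_hom_sup (hHL : C (H ⧸ (H ⊓ K).subgroupOf H)) {T : Subgroup B}
    {X : Type u} [Group X] (g : ↥(H ⊓ K) →* X) (hX : C X) (hg : ∀ l, g l = 1 → (l : B) ∈ T) :
    ∃ (X : Type u) (_ : Group X) (g : ↥(H ⊔ K) →* X), C X ∧ ∀ y, g y = 1 → (y : B) ∈ T := by
  let π := QuotientGroup.mk' ((H ⊓ K).subgroupOf H)
  have hπ : ∀ h, π h = 1 ↔ (h : B) ∈ H ⊓ K := fun h => by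
    rw [QuotientGroup.mk'_apply, QuotientGroup.eq_one_iff, mem_subgroupOf]
  let p := π.comp φ.symm.toMonoidHom
  have hp : ∀ k, p k = 1 → (k : B) ∈ H ⊓ K := fun k hk => by
    have h1 := (hπ _).1 hk
    have h2 := hψ ⟨_, h1⟩
    have h3 : φ ⟨((φ.symm k : H) : B), (φ.symm k).2⟩ = k := φ.apply_symm_apply k
    rw [show (k : B) = ψ ⟨_, h1⟩ from by rw [h2]; exact congrArg Subtype.val h3.symm]
    exact (ψ _).2
  obtain ⟨X₂, _, g₂, hX₂, hg₂⟩ := hC.exists_hom_of_ker_hom p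
    (g.comp (((K.subtype.comp p.ker.subtype)).codRestrict (H ⊓ K) fun k => hp _ k.2)) hHL hX
  obtain ⟨ρ, hρ, hρ'⟩ := exists_extend_sup H K π fun h hh => (hπ h).2 ⟨h.2, hh⟩
  let p₁ : ↥(H ⊔ K) →* H ⧸ (H ⊓ K).subgroupOf H :=
    MonoidHom.mk' (fun y => ρ y) fun a b => hρ _ a.2 _ b.2
  have hp₁ : ∀ y, p₁ y = 1 → (y : B) ∈ K := fun y hy => by
    have h1 := (extend_eq_one_iff hρ' y.2).1 hy
    refine (sup_le ?_ le_rfl : π.ker.map H.subtype ⊔ K ≤ K) h1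
    rintro _ ⟨h, hh, rfl⟩
    exact ((hπ h).1 hh).2
  obtain ⟨X₁, _, g₁, hX₁, hg₁⟩ := hC.exists_hom_of_ker_hom p₁
    (g₂.comp ((((H ⊔ K).subtype.comp p₁.ker.subtype)).codRestrict K fun k => hp₁ _ k.2)) hHL hX₂
  refine ⟨X₁, _, g₁, hX₁, fun y hy => ?_⟩
  obtain ⟨h1, h2⟩ := hg₁ y hy
  obtain ⟨h3, h4⟩ := hg₂ _ h2
  exact hg _ h4

end IsRootClass

open HNNExtension NormalWord in
theorem HNNExtension.residually_of_residually {C : GroupClass.{u}} (hC : IsRootClass C)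
    (hquot : QuotClosed C)
    {B : Type u} [Group B] {H K : Subgroup B} {φ : H ≃* K} [H.Normal] [K.Normal]
    {ψ : MulAut ↥(H ⊓ K)} (hψ : IsRestrictionToL H K φ ψ)
    (hHL : C (↥H ⧸ (H ⊓ K).subgroupOf H)) (hF : C ↥(Subgroup.zpowers ψ))
    (hdag : CondDag C H K φ) (hddag : CondDDag C H K ψ)
    (hext : ∀ T : Subgroup B, T.Normal → T ≤ H ⊔ K →
      inCStar C ↥(H ⊔ K) (T.subgroupOf (H ⊔ K)) → ∃ N, inCStar C B N ∧ N ⊓ (H ⊔ K) ≤ T)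
    (hBH : Residually C (B ⧸ H)) (hBK : Residually C (B ⧸ K)) (hB : Residually C B) :
    Residually C (HNNExtension B H K φ) := by
  refine residually_of_forall hC fun x hx => ?_
  obtain ⟨d⟩ := TransversalPair.nonempty B H K
  obtain ⟨w, rfl⟩ := (NormalWord.equiv (φ := φ) (d := d)).symm.surjective x
  let w := w.toReducedWord
  change w.prod φ ≠ 1 at hx
  change ∃ (G : Type u) (_ : Group G) (f : HNNExtension B H K φ →* G), C G ∧ f (w.prod φ) ≠ 1
  obtain ⟨R₀, hR₀, hR₀'⟩ : ∃ N, inCStar C B N ∧ (w.head ≠ 1 → w.head ∉ N) := by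
    by_cases h : w.head = 1
    · exact ⟨⊤, inCStar_top hC, fun h' => absurd h h'⟩
    · obtain ⟨G, _, f, -, hG, hf⟩ := hB _ h
      exact ⟨f.ker, inCStar_of_ker hC f hG, fun _ => hf⟩
  obtain ⟨R₁, hR₁, hR₁'⟩ := exists_inCStar_list hC
    (fun (x : ℤˣ × B) N => x.2 ∉ toSubgroup H K x.1 → ∀ a ∈ toSubgroup H K x.1, x.2 * a⁻¹ ∉ N)
    (fun x M N hMN h hx a ha h' => h hx a ha (hMN h')) w.toList (fun x _ => by
      obtain ⟨e, b⟩ := x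
      by_cases hb : b ∈ toSubgroup H K e
      · exact ⟨⊤, inCStar_top hC, fun h' => absurd hb h'⟩
      · obtain ⟨N, hN, hN'⟩ : ∃ N, inCStar C B N ∧ ∀ a ∈ toSubgroup H K e, b * a⁻¹ ∉ N := by
          rcases Int.units_eq_one_or e with rfl | rfl
          · exact hBH.exists_inCStar hC hb
          · exact hBK.exists_inCStar hC hb
        exact ⟨N, hN, fun _ => hN'⟩)
  have hR := hR₀.inf hC hR₁
  obtain ⟨T, hT, hTL, hTR, hTφ, X, _, g, hX, hg⟩ := hC.exists_invariant_le hψ hddag hF hR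
  have hTY : T ≤ H ⊔ K := hTL.trans (inf_le_left.trans le_sup_left)
  obtain ⟨X', _, g', hX', hg'⟩ := hC.exists_hom_sup hψ hHL g hX hg
  obtain ⟨N, hN, hN'⟩ := hext T hT hTY
    ((inCStar_of_ker hC g' hX').mono hC hquot inferInstance fun y hy => hg' y hy)
  obtain ⟨hMn, -⟩ := hN.inf hC hR
  have hQ : inCStar C B ((N ⊓ (R₀ ⊓ R₁)) ⊔ T) :=
    (hN.inf hC hR).mono hC hquot inferInstance le_sup_left
  have hQR : (N ⊓ (R₀ ⊓ R₁)) ⊔ T ≤ R₀ ⊓ R₁ := sup_le inf_le_right hTR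
  have hQT : ((N ⊓ (R₀ ⊓ R₁)) ⊔ T) ⊓ (H ⊔ K) = T := by
    refine le_antisymm ?_ (le_inf le_sup_right hTY)
    rintro b ⟨hb, hbY⟩
    obtain ⟨n, t, ht, rfl⟩ := exists_mul_of_mem_sup_normal hb
    refine T.mul_mem (hN' ⟨n.2.1, ?_⟩) ht
    exact ((H ⊔ K).mul_mem_cancel_right (hTY ht)).1 hbY
  obtain ⟨_, hQ⟩ := hQ
  obtain ⟨G, _, f, hG, hf⟩ := exists_hom_ker_of hC hquot hTL hQT hψ hTφ hQ hHL hdag hddag hF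
  by_cases hw : w.toList = []
  · refine ⟨G, _, f, hG, fun h => ?_⟩
    have h1 : w.prod φ = of w.head := by simp [ReducedWord.prod, hw]
    rw [h1] at h hx
    rw [hf] at h
    exact hR₀' (fun h => hx (by rw [h, map_one])) (hQR h).1
  · refine hC.exists_hom_reducedWord hquot f hG w hw fun x hx hx' a ha h => ?_
    refine hR₁' x hx hx' a ha (hQR ((hf _).1 ?_)).2
    rw [map_mul, map_mul, h, map_inv, map_inv, mul_inv_cancel]

namespace LocallyCyclic

variable {G : Type u} [Group G] (h : LocallyCyclic G)
include h

theorem exists_zpow_eq (x y : G) :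
    ∃ c ∈ closure {x, y}, (∃ i : ℤ, c ^ i = x) ∧ ∃ j : ℤ, c ^ j = y := by
  obtain ⟨c, hc⟩ := h (closure {x, y}) ((fg_iff _).2 ⟨{x, y}, rfl, by simp⟩)
  obtain ⟨i, hi⟩ := hc ⟨x, subset_closure (by simp)⟩
  obtain ⟨j, hj⟩ := hc ⟨y, subset_closure (by simp)⟩
  exact ⟨c, c.2, ⟨i, congrArg Subtype.val hi⟩, ⟨j, congrArg Subtype.val hj⟩⟩

theorem mul_comm (x y : G) : x * y = y * x := by
  obtain ⟨c, -, ⟨i, rfl⟩, j, rfl⟩ := h.exists_zpow_eq x y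
  rw [← zpow_add, ← zpow_add, add_comm]

theorem mem_zpowers_of_orderOf_eq {x y : G} (hx : IsOfFinOrder x) (hxy : orderOf x = orderOf y) :
    y ∈ zpowers x := by
  let _ : CommGroup G := { ‹Group G› with mul_comm := h.mul_comm }
  obtain ⟨c, hc, ⟨i, hi⟩, j, hj⟩ := h.exists_zpow_eq x y
  have h1 : closure {x, y} ≤ (powMonoidHom (orderOf x) : G →* G).ker := by
    rw [closure_le]
    rintro z (rfl | rfl)
    · exact pow_orderOf_eq_one _
    · change z ^ orderOf x = 1
      rw [hxy]
      exact pow_orderOf_eq_one _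
  have hcx : orderOf c ∣ orderOf x := orderOf_dvd_of_pow_eq_one (h1 hc)
  have hcf : IsOfFinOrder c := orderOf_pos_iff.1 (Nat.pos_of_dvd_of_pos hcx hx.orderOf_pos)
  have hle : zpowers x ≤ zpowers c := by
    rw [zpowers_le, ← hi]
    exact zpow_mem_zpowers c i
  have : Finite (zpowers c) := finite_zpowers.2 hcf
  have heq := eq_of_le_of_card_ge hle (by
    rw [Nat.card_zpowers, Nat.card_zpowers]
    exact Nat.le_of_dvd hx.orderOf_pos hcx)
  rw [heq, ← hj]
  exact zpow_mem_zpowers c j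

theorem exists_zpow_apply (α : MulAut G) (x : G) : ∃ a b : ℤ, b ≠ 0 ∧ α x ^ b = x ^ a := by
  by_cases hx : IsOfFinOrder x
  · obtain ⟨m, hm⟩ := h.mem_zpowers_of_orderOf_eq hx (MulEquiv.orderOf_eq α x).symm
    exact ⟨m, 1, one_ne_zero, by rw [zpow_one]; exact hm.symm⟩
  · obtain ⟨c, -, ⟨i, hi⟩, j, hj⟩ := h.exists_zpow_eq x (α x)
    refine ⟨j, i, fun hi0 => hx ?_, ?_⟩
    · rw [← hi, hi0, zpow_zero]
      exact IsOfFinOrder.one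
    · calc α x ^ i = c ^ (j * i) := by rw [← hj, zpow_mul]
        _ = x ^ j := by rw [Int.mul_comm, zpow_mul, hi]

theorem mulAut_comm (α β : MulAut G) : α * β = β * α := by
  ext x
  rw [MulAut.mul_apply, MulAut.mul_apply]
  by_cases hx : IsOfFinOrder x
  · obtain ⟨m, hm⟩ := h.mem_zpowers_of_orderOf_eq hx (MulEquiv.orderOf_eq α x).symm
    obtain ⟨n, hn⟩ := h.mem_zpowers_of_orderOf_eq hx (MulEquiv.orderOf_eq β x).symm
    have hm : x ^ m = α x := hm
    have hn : x ^ n = β x := hn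
    rw [← hm, ← hn, map_zpow, map_zpow, ← hm, ← hn, ← zpow_mul, ← zpow_mul, Int.mul_comm]
  · let _ : CommGroup G := { ‹Group G› with mul_comm := h.mul_comm }
    obtain ⟨a, b, hb, hab⟩ := h.exists_zpow_apply α x
    obtain ⟨d, e, he, hde⟩ := h.exists_zpow_apply β x
    have h1 : α (β x) ^ (b * e) = x ^ (a * d) := by
      rw [Int.mul_comm, zpow_mul, ← map_zpow, hde, map_zpow, ← zpow_mul, Int.mul_comm, zpow_mul,
        hab, ← zpow_mul]
    have h2 : β (α x) ^ (b * e) = x ^ (a * d) := by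
      rw [zpow_mul, ← map_zpow, hab, map_zpow, ← zpow_mul, Int.mul_comm, zpow_mul, hde,
        ← zpow_mul, Int.mul_comm]
    set z := α (β x) * (β (α x))⁻¹ with hz
    have hz1 : z ^ (b * e) = 1 := by
      rw [hz, mul_zpow, inv_zpow, h1, h2, mul_inv_cancel]
    obtain ⟨c, -, ⟨i, hi⟩, j, hj⟩ := h.exists_zpow_eq x z
    have hc : ¬ IsOfFinOrder c := fun hc => hx (hi ▸ hc.zpow)
    have hinj := injective_zpow_iff_not_isOfFinOrder.2 hc
    have h3 : j * (b * e) = 0 := hinj (by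
      simp only
      rw [zpow_mul, hj, hz1, zpow_zero])
    have h4 : j = 0 := by
      rcases mul_eq_zero.1 h3 with h | h
      · exact h
      · exact absurd h (mul_ne_zero hb he)
    rw [h4, zpow_zero] at hj
    exact mul_inv_eq_one.1 (hz.symm.trans hj.symm)

theorem of_injective {G' : Type u} [Group G'] (f : G' →* G) (hf : Function.Injective f) :
    LocallyCyclic G' := by
  intro S hS
  have : IsCyclic (S.map f) := h _ (by
    obtain ⟨s, rfl⟩ := hS
    classical
    exact ⟨s.image f, by rw [Finset.coe_image, ← MonoidHom.map_closure]⟩)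
  exact isCyclic_of_injective (S.equivMapOfInjective f hf).toMonoidHom
    (S.equivMapOfInjective f hf).injective

theorem normalIn (A U : Subgroup (MulAut G)) : NormalIn A U := by
  refine ⟨fun a ha u => ?_⟩
  have : u * a * u⁻¹ = a := by
    rw [mul_inv_eq_iff_eq_mul]
    exact Subtype.ext (h.mulAut_comm _ _)
  rwa [this]

end LocallyCyclic

section

variable {C : GroupClass.{u}}

theorem Module.exists_injective_pi {F V Z : Type*} [Field F] [AddCommGroup V] [Module F V]
    (e : V ↪ Z) : ∃ f : V →+ (Z → F), Function.Injective f := by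
  let b := Module.Basis.ofVectorSpace F V
  let r : Module.Basis.ofVectorSpaceIndex F V → Z := fun i => e i.1
  have hr : Function.Injective r := fun i j h => Subtype.ext (e.injective h)
  refine ⟨{ toFun := fun v => Function.extend r (b.repr v) 0
            map_zero' := ?_
            map_add' := fun v w => ?_ }, fun v w hvw => b.repr.injective ?_⟩
  · rw [map_zero, Finsupp.coe_zero, Function.extend_zero]
  · rw [map_add, Finsupp.coe_add, ← Function.extend_add, add_zero]
  · ext i
    have := congrFun hvw (r i)
    simpa [hr.extend_apply] using this

theorem IsRootClass.of_pow_prime_eq_one (hC : IsRootClass C) {A Z : Type u} [CommGroup A] [Group Z]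
    {p : ℕ} (hp : p.Prime) (hCp : C (ULift.{u} (Multiplicative (ZMod p))))
    (hA : ∀ a : A, a ^ p = 1) (hZ : C Z) (hle : Cardinal.mk A ≤ Cardinal.mk Z) : C A := by
  have : Fact p.Prime := ⟨hp⟩
  let _ : Module (ZMod p) (Additive A) := AddCommGroup.zmodModule fun a => hA a.toMul
  obtain ⟨e⟩ := hle
  obtain ⟨f, hf⟩ := Module.exists_injective_pi (F := ZMod p) (V := Additive A)
    (Additive.toMul.toEmbedding.trans e)
  refine hC.of_injective
    { toFun := fun a z => ULift.up.{u} (Multiplicative.ofAdd (f (Additive.ofMul a) z))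
      map_one' := by ext; simp
      map_mul' := fun x y => by ext; simp } ?_ (hC.pi hCp hZ)
  intro x y hxy
  refine Additive.ofMul.injective (hf (funext fun z => ?_))
  simpa using congrFun hxy z

theorem IsRootClass.of_commGroup_of_pow_eq_one (hC : IsRootClass C) (hquot : QuotClosed C) (n : ℕ) :
    ∀ (A : Type u) [CommGroup A], 0 < n → (∀ a : A, a ^ n = 1) →
      (∀ p : ℕ, p.Prime → p ∣ n → p ∈ primesOf C ∧ ∃ (Z : Type u) (_ : Group Z), C Z ∧
        Cardinal.mk {a : A // ∃ k : ℕ, a ^ p ^ k = 1} ≤ Cardinal.mk Z) → C A := by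
  induction n using Nat.strong_induction_on with
  | _ n ih =>
    intro A _ hn hA hp
    by_cases h1 : n = 1
    · have : Subsingleton A := ⟨fun a b => by simpa [h1] using (hA a).trans (hA b).symm⟩
      exact hC.of_subsingleton A
    · have hmin := Nat.minFac_prime h1
      obtain ⟨m, hm⟩ := Nat.minFac_dvd n
      set p := n.minFac
      obtain ⟨⟨-, G, _, hG, g, hg⟩, Z, _, hZ, hle⟩ := hp p hmin ⟨m, hm⟩
      have hm0 : 0 < m := Nat.pos_of_ne_zero fun h => by simp [h] at hm; omega
      let f : A →* A := powMonoidHom p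
      refine hC.of_ker f.rangeRestrict ?_ ?_
      · refine ih m ?_ f.range hm0 ?_ ?_
        · rw [hm]
          exact (Nat.lt_mul_iff_one_lt_left hm0).2 hmin.one_lt
        · rintro ⟨_, a, rfl⟩
          apply Subtype.ext
          change (a ^ p) ^ m = 1
          rw [← pow_mul, ← hm, hA]
        · intro q hq hqm
          obtain ⟨h1, W, _, hW, hle⟩ := hp q hq (hqm.trans ⟨p, hm.trans (mul_comm _ _)⟩)
          refine ⟨h1, W, _, hW, (Cardinal.mk_le_of_injective
            (f := fun a => ⟨a.1.1, a.2.imp fun k hk => congrArg Subtype.val hk⟩) ?_).trans hle⟩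
          intro a b hab
          exact Subtype.ext (Subtype.ext (Subtype.mk.inj hab))
      · have hker : ∀ a : f.rangeRestrict.ker, a ^ p = 1 := by
          rintro ⟨a, ha⟩
          have ha : f.rangeRestrict a = 1 := ha
          have ha' : a ^ p = 1 := congrArg Subtype.val ha
          exact Subtype.ext ha'
        refine hC.of_pow_prime_eq_one hmin (hC.zmod_of_dvd_orderOf hquot hG g p hg)
          hker hZ ((Cardinal.mk_le_of_injective (f := fun a => ⟨a.1, 1, by
            rw [pow_one]; exact congrArg Subtype.val (hker a)⟩) ?_).trans hle)
        intro a b hab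
        exact Subtype.ext (Subtype.mk.inj hab)

theorem CBoundedAbelian.of_surjective {A A' : Type u} [Group A] [Group A']
    (h : CBoundedAbelian C A) (f : A →* A') (hf : Function.Surjective f) :
    (∀ a b : A', a * b = b * a) ∧ ∀ p ∈ primesOf C,
      (∃ m : ℕ, 0 < m ∧ ∀ x : A', (∃ n : ℕ, x ^ p ^ n = 1) → x ^ m = 1) ∧
      (∃ (Z : Type u) (_ : Group Z), C Z ∧
        Cardinal.mk {x : A' // ∃ n : ℕ, x ^ p ^ n = 1} ≤ Cardinal.mk Z) := by
  obtain ⟨hcomm, hb⟩ := h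
  refine ⟨fun a b => ?_, fun p hp => ?_⟩
  · obtain ⟨a, rfl⟩ := hf a
    obtain ⟨b, rfl⟩ := hf b
    rw [← map_mul, hcomm, map_mul]
  · obtain ⟨⟨m, hm, hm'⟩, Z, _, hZ, hle⟩ := hb f.ker inferInstance p hp
    let e := QuotientGroup.quotientKerEquivOfSurjective f hf
    have key : ∀ x : A', (∃ n : ℕ, x ^ p ^ n = 1) → ∃ n : ℕ, e.symm x ^ p ^ n = 1 :=
      fun x ⟨n, hn⟩ => ⟨n, by rw [← map_pow, hn, map_one]⟩
    refine ⟨⟨m, hm, fun x hx => e.symm.injective ?_⟩, Z, _, hZ,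
      (Cardinal.mk_le_of_injective (f := fun x => ⟨e.symm x.1, key _ x.2⟩) ?_).trans hle⟩
    · rw [map_pow, map_one, hm' _ (key x hx)]
    · intro a b hab
      exact Subtype.ext (e.symm.injective (congrArg Subtype.val hab))

end

theorem Group.IsNilpotent.exists_pow_eq_one (X : Type*) [Group X] [Group.IsNilpotent X] :
    ∀ m : ℕ, (∀ z ∈ center X, z ^ m = 1) → ∃ c : ℕ, ∀ x : X, x ^ m ^ c = 1 := by
  refine Group.nilpotent_center_quotient_ind (P := fun X _ _ => ∀ m : ℕ,
    (∀ z ∈ center X, z ^ m = 1) → ∃ c : ℕ, ∀ x : X, x ^ m ^ c = 1) X ?_ ?_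
  · intro X _ _ m _
    exact ⟨0, fun x => Subsingleton.elim _ _⟩
  · intro X _ _ ih m hm
    obtain ⟨c, hc⟩ := ih m (fun z hz => by
      obtain ⟨x, rfl⟩ := QuotientGroup.mk_surjective z
      rw [← QuotientGroup.mk_pow, QuotientGroup.eq_one_iff, mem_center_iff]
      intro y
      have h1 : y * x * y⁻¹ * x⁻¹ ∈ center X := by
        rw [← QuotientGroup.eq_one_iff]
        have := mem_center_iff.1 hz (y : X ⧸ center X)
        simp only [QuotientGroup.mk_mul, QuotientGroup.mk_inv]
        rw [this]
        group
      have h2 : y * x * y⁻¹ = (y * x * y⁻¹ * x⁻¹) * x := by group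
      have h3 : Commute (y * x * y⁻¹ * x⁻¹) x := (mem_center_iff.1 h1 x).symm
      have h4 : y * x ^ m * y⁻¹ = x ^ m := by
        rw [← conj_pow, h2, h3.mul_pow, hm _ h1, one_mul]
      exact mul_inv_eq_iff_eq_mul.1 h4)
    refine ⟨c + 1, fun x => ?_⟩
    rw [pow_succ, pow_mul]
    apply hm
    rw [← QuotientGroup.eq_one_iff, QuotientGroup.mk_pow]
    exact hc _

section

variable {C : GroupClass.{u}}

theorem CBoundedNilpotent.isNilpotent {B : Type u} [Group B] (h : CBoundedNilpotent C B) :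
    Group.IsNilpotent B := by
  obtain ⟨n, S, h0, hn, -, -, hcent, -⟩ := h
  refine (Subgroup.nilpotent_iff_finite_ascending_central_series B).2
    ⟨n, fun i => if i ≤ n then S i else ⊤, ⟨by simpa using h0, fun x i hx g => ?_⟩, by simpa using hn⟩
  by_cases hi : i < n
  · have hx : x ∈ S (i + 1) := by simpa [Nat.succ_le_of_lt hi] using hx
    have h1 := (S i).inv_mem (hcent i hi x⁻¹ (inv_mem hx) g⁻¹)
    simp only [if_pos hi.le]
    convert h1 using 1
    rw [commutatorElement_def]
    group
  · by_cases hi' : i = n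
    · simp [hi', hn]
    · simp [show ¬ i ≤ n by omega]

theorem exists_maximal_normal_inf_le {B : Type*} [Group B] {T Y : Subgroup B} (hT : T.Normal) :
    ∃ N : Subgroup B, T ≤ N ∧
      Maximal (fun M : Subgroup B => M.Normal ∧ M ⊓ Y ≤ T) N := by
  refine zorn_le_nonempty₀ {M : Subgroup B | M.Normal ∧ M ⊓ Y ≤ T} (fun c hc hch y hy => ?_) T
    ⟨hT, inf_le_left⟩
  have hmem : ∀ x, x ∈ sSup c ↔ ∃ M ∈ c, x ∈ M := fun x =>
    mem_sSup_of_directedOn ⟨y, hy⟩ hch.directedOn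
  refine ⟨sSup c, ⟨⟨fun x hx g => ?_⟩, fun x hx => ?_⟩, fun M hM => le_sSup hM⟩
  · obtain ⟨M, hM, hx⟩ := (hmem x).1 hx
    exact (hmem _).2 ⟨M, hM, (hc hM).1.conj_mem x hx g⟩
  · obtain ⟨M, hM, hxM⟩ := (hmem x).1 hx.1
    exact (hc hM).2 ⟨hxM, hx.2⟩

theorem exists_zpow_eq_of_mem_center {B : Type*} [Group B] {N T Y : Subgroup B} [N.Normal]
    (hmax : Maximal (fun M : Subgroup B => M.Normal ∧ M ⊓ Y ≤ T) N) {z : B ⧸ N}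
    (hz : z ∈ center (B ⧸ N)) (hz1 : z ≠ 1) :
    ∃ k : ℤ, ∃ y ∈ Y, y ∉ T ∧ (y : B ⧸ N) = z ^ k := by
  have hMn : (zpowers z).Normal := ⟨fun x hx g => by
    have : x ∈ center (B ⧸ N) := (zpowers_le.2 hz) hx
    rw [mem_center_iff.1 this g, mul_inv_cancel_right]
    exact hx⟩
  set M := (zpowers z).comap (QuotientGroup.mk' N) with hM
  have hNM : N ≤ M := fun x hx => by
    have : QuotientGroup.mk' N x = 1 := by simpa using hx
    rw [hM, mem_comap, this]
    exact one_mem _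
  have h1 : ¬ M ⊓ Y ≤ T := fun h => hz1 (by
    obtain ⟨x, rfl⟩ := QuotientGroup.mk_surjective z
    exact (QuotientGroup.eq_one_iff x).2 (hmax.2 ⟨hMn.comap _, h⟩ hNM (mem_zpowers _)))
  obtain ⟨y, hy, hyT⟩ := SetLike.not_le_iff_exists.1 h1
  obtain ⟨k, hk⟩ := hy.1
  exact ⟨k, y, hy.2, hyT, hk.symm⟩

end

section

variable {C : GroupClass.{u}} {B : Type u} [Group B] {N T Y : Subgroup B} [N.Normal]

theorem prime_dvd_of_mem_center (hTN : T ≤ N)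
    (hmax : Maximal (fun M : Subgroup B => M.Normal ∧ M ⊓ Y ≤ T) N)
    (hTY : inCStar C Y (T.subgroupOf Y)) {e : ℕ} (he : 0 < e)
    (hexp : ∀ y ∈ Y, y ^ e ∈ T) {z : B ⧸ N} (hz : z ∈ center (B ⧸ N)) :
    0 < orderOf z ∧ ∀ q : ℕ, q.Prime → q ∣ orderOf z → q ∣ e ∧ q ∈ primesOf C := by
  have hne : ∀ {y}, y ∈ Y → y ∉ T → (y : B ⧸ N) ≠ 1 := fun hy hyT h =>
    hyT (hmax.1.2 ⟨(QuotientGroup.eq_one_iff _).1 h, hy⟩)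
  have hfin : ∀ z ∈ center (B ⧸ N), 0 < orderOf z := by
    intro z hz
    by_cases hz1 : z = 1
    · simp [hz1]
    · obtain ⟨k, y, hy, hyT, hk⟩ := exists_zpow_eq_of_mem_center hmax hz hz1
      rw [orderOf_pos_iff, isOfFinOrder_iff_zpow_eq_one]
      refine ⟨k * e, mul_ne_zero ?_ (by exact_mod_cast he.ne'), ?_⟩
      · rintro rfl
        exact hne hy hyT (by simpa using hk)
      · rw [zpow_mul, ← hk, zpow_natCast, ← QuotientGroup.mk_pow, QuotientGroup.eq_one_iff]
        exact hTN (hexp y hy)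
  refine ⟨hfin z hz, fun q hq hqz => ?_⟩
  have : Fact q.Prime := ⟨hq⟩
  obtain ⟨w, hw, hwq⟩ : ∃ w ∈ center (B ⧸ N), orderOf w = q :=
    ⟨_, pow_mem hz (orderOf z / q), orderOf_pow_orderOf_div (hfin z hz).ne' hqz⟩
  obtain ⟨k, y, hy, hyT, hk⟩ := exists_zpow_eq_of_mem_center hmax hw
    (fun h => hq.one_lt.ne' (by rw [← hwq, h, orderOf_one]))
  have hyq : orderOf (y : B ⧸ N) = q := orderOf_eq_prime
    (by rw [hk, ← zpow_natCast, zpow_comm, zpow_natCast,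
      orderOf_dvd_iff_pow_eq_one.1 hwq.dvd, one_zpow])
    (hne hy hyT)
  obtain ⟨_, hTY⟩ := hTY
  have hdvd : ∀ n : ℕ, y ^ n ∈ T → q ∣ n := fun n hn => by
    rw [← hyq]
    refine orderOf_dvd_of_pow_eq_one ?_
    rw [← QuotientGroup.mk_pow, QuotientGroup.eq_one_iff]
    exact hTN hn
  refine ⟨hdvd e (hexp y hy), hq, _, _, hTY, ((⟨y, hy⟩ : Y) : Y ⧸ T.subgroupOf Y), hdvd _ ?_⟩
  have := pow_orderOf_eq_one ((⟨y, hy⟩ : Y) : Y ⧸ T.subgroupOf Y)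
  rwa [← QuotientGroup.mk_pow, QuotientGroup.eq_one_iff, mem_subgroupOf] at this

theorem exists_exponent_center (hTN : T ≤ N)
    (hmax : Maximal (fun M : Subgroup B => M.Normal ∧ M ⊓ Y ≤ T) N)
    (hTY : inCStar C Y (T.subgroupOf Y)) {e : ℕ} (he : 0 < e) (hexp : ∀ y ∈ Y, y ^ e ∈ T)
    (htors : ∀ q ∈ primesOf C, ∃ m : ℕ, 0 < m ∧
      ∀ x : B ⧸ N, (∃ k : ℕ, x ^ q ^ k = 1) → x ^ m = 1) :
    ∃ m : ℕ, 0 < m ∧ (∀ q : ℕ, q.Prime → q ∣ m → q ∈ primesOf C) ∧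
      ∀ z ∈ center (B ⧸ N), z ^ m = 1 := by
  classical
  choose! m hm hmx using htors
  set P := e.primeFactors.filter (· ∈ primesOf C) with hP
  have hPC : ∀ q ∈ P, q ∈ primesOf C := fun q hq => (Finset.mem_filter.1 hq).2
  set M := ∏ q ∈ P, m q with hM
  have hM0 : 0 < M := Finset.prod_pos fun q hq => hm q (hPC q hq)
  refine ⟨(∏ q ∈ P, q) ^ M, pow_pos (Finset.prod_pos fun q hq => (hPC q hq).1.pos) _,
    fun q hq hqm => ?_, fun z hz => ?_⟩
  · obtain ⟨p, hp, hqp⟩ := (hq.prime.dvd_finsetProd_iff _).1 (hq.dvd_of_dvd_pow hqm)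
    rw [(Nat.prime_dvd_prime_iff_eq hq (hPC p hp).1).1 hqp]
    exact hPC p hp
  · obtain ⟨hz0, hzq⟩ := prime_dvd_of_mem_center hTN hmax hTY he hexp hz
    rw [← orderOf_dvd_iff_pow_eq_one, Nat.dvd_iff_prime_pow_dvd_dvd]
    intro q k hq hqk
    rcases Nat.eq_zero_or_pos k with rfl | hk
    · simp
    obtain ⟨hqe, hqC⟩ := hzq q hq ((dvd_pow_self q hk.ne').trans hqk)
    have hqP : q ∈ P := Finset.mem_filter.2 ⟨Nat.mem_primeFactors.2 ⟨hq, hqe, he.ne'⟩, hqC⟩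
    have hord : orderOf (z ^ (orderOf z / q ^ k)) = q ^ k := orderOf_pow_orderOf_div hz0.ne' hqk
    have hqm : q ^ k ∣ m q := by
      rw [← hord]
      refine orderOf_dvd_of_pow_eq_one (hmx q hqC _ ⟨k, ?_⟩)
      exact orderOf_dvd_iff_pow_eq_one.1 hord.dvd
    have hkM : k ≤ M := ((Nat.lt_pow_self hq.one_lt).le.trans
      (Nat.le_of_dvd (hm q hqC) hqm)).trans
      (Nat.le_of_dvd hM0 (Finset.dvd_prod_of_mem m hqP))
    exact (pow_dvd_pow q hkM).trans (pow_dvd_pow_of_dvd (Finset.dvd_prod_of_mem id hqP) M)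

end

section

variable {C : GroupClass.{u}} {B : Type u} [Group B]

theorem CBoundedAbelian.range_mk {S S' N : Subgroup B} [S.Normal] [N.Normal]
    (h : ∀ _ : (S.subgroupOf S').Normal, CBoundedAbelian C (↥S' ⧸ S.subgroupOf S')) :
    ∃ R : Subgroup (B ⧸ (S ⊔ N)), (∀ x ∈ S' ⊔ N, (x : B ⧸ (S ⊔ N)) ∈ R) ∧
    (∀ a b : R, a * b = b * a) ∧ ∀ p ∈ primesOf C,
      (∃ m : ℕ, 0 < m ∧ ∀ x : R, (∃ n : ℕ, x ^ p ^ n = 1) → x ^ m = 1) ∧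
      (∃ (Z : Type u) (_ : Group Z), C Z ∧
        Cardinal.mk {x : R // ∃ n : ℕ, x ^ p ^ n = 1} ≤ Cardinal.mk Z) := by
  let g : ↥S' ⧸ S.subgroupOf S' →* B ⧸ (S ⊔ N) :=
    QuotientGroup.map _ (S ⊔ N) S'.subtype fun x hx => le_sup_left (a := S) hx
  refine ⟨g.range, fun x hx => ?_,
    (h inferInstance).of_surjective g.rangeRestrict g.rangeRestrict_surjective⟩
  obtain ⟨y, n, hn, rfl⟩ := exists_mul_of_mem_sup_normal hx
  refine ⟨(y : ↥S' ⧸ S.subgroupOf S'), ?_⟩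
  change ((y : B) : B ⧸ (S ⊔ N)) = _
  rw [QuotientGroup.eq, inv_mul_cancel_left]
  exact le_sup_right (a := S) hn

theorem CBoundedNilpotent.exists_exponent_torsion (h : CBoundedNilpotent C B) (N : Subgroup B)
    [N.Normal] {q : ℕ} (hq : q ∈ primesOf C) :
    ∃ m : ℕ, 0 < m ∧ ∀ x : B ⧸ N, (∃ k : ℕ, x ^ q ^ k = 1) → x ^ m = 1 := by
  obtain ⟨n, S, h0, hn, -, hnorm, -, hb⟩ := h
  suffices ∀ j ≤ n, ∃ m : ℕ, 0 < m ∧ ∀ x : B, (∃ k : ℕ, x ^ q ^ k ∈ N) →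
      x ^ m ∈ S (n - j) ⊔ N by
    obtain ⟨m, hm, hmx⟩ := this n le_rfl
    refine ⟨m, hm, fun x ⟨k, hk⟩ => ?_⟩
    obtain ⟨x, rfl⟩ := QuotientGroup.mk_surjective x
    rw [← QuotientGroup.mk_pow, QuotientGroup.eq_one_iff] at hk ⊢
    simpa [h0] using hmx x ⟨k, hk⟩
  intro j
  induction j with
  | zero => exact fun _ => ⟨1, one_pos, fun x _ => by simp [hn]⟩
  | succ j ih =>
    intro hj
    obtain ⟨m, hm, hmx⟩ := ih (by omega)
    set i := n - (j + 1) with hi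
    have hi1 : n - j = i + 1 := by omega
    have hin : i < n := by omega
    rw [hi1] at hmx
    have := hnorm i hin
    obtain ⟨R, hR, -, hRb⟩ := CBoundedAbelian.range_mk (N := N) (hb i hin)
    obtain ⟨⟨m', hm', hmx'⟩, -⟩ := hRb q hq
    refine ⟨m * m', Nat.mul_pos hm hm', fun x ⟨k, hk⟩ => ?_⟩
    have h1 := hmx' ⟨_, hR _ (hmx x ⟨k, hk⟩)⟩ ⟨k, Subtype.ext ?_⟩
    · have h2 : ((x ^ m : B) : B ⧸ (S i ⊔ N)) ^ m' = 1 := congrArg Subtype.val h1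
      rwa [← QuotientGroup.mk_pow, QuotientGroup.eq_one_iff, ← pow_mul] at h2
    · change ((x ^ m : B) : B ⧸ (S i ⊔ N)) ^ q ^ k = 1
      rw [← QuotientGroup.mk_pow, QuotientGroup.eq_one_iff, ← pow_mul, mul_comm, pow_mul]
      exact le_sup_right (a := S i) (pow_mem hk m)

theorem CBoundedNilpotent.inCStar_of_exponent (hC : IsRootClass C) (hquot : QuotClosed C)
    (h : CBoundedNilpotent C B) (N : Subgroup B) [N.Normal] {n : ℕ} (hn : 0 < n)
    (hprime : ∀ q : ℕ, q.Prime → q ∣ n → q ∈ primesOf C) (hexp : ∀ x : B, x ^ n ∈ N) :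
    inCStar C B N := by
  obtain ⟨l, S, h0, hl, hle, hnorm, -, hb⟩ := h
  suffices ∀ j ≤ l, inCStar C B (S (l - j) ⊔ N) by
    simpa [h0] using this l le_rfl
  intro j
  induction j with
  | zero =>
    intro _
    simpa [hl] using inCStar_top hC
  | succ j ih =>
    intro hj
    obtain ⟨_, ih⟩ := ih (by omega)
    set i := l - (j + 1) with hi
    have hi1 : l - j = i + 1 := by omega
    have hil : i < l := by omega
    have := hnorm i hil
    have hle' : S i ⊔ N ≤ S (l - j) ⊔ N := by
      rw [hi1]
      exact sup_le_sup_right (hle i hil) N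
    obtain ⟨R, hR, hcomm, hRb⟩ := CBoundedAbelian.range_mk (N := N) (hb i hil)
    let _ : CommGroup R := { (inferInstance : Group R) with mul_comm := hcomm }
    have hRC : C R := hC.of_commGroup_of_pow_eq_one hquot n R hn (fun a => by
      obtain ⟨⟨x⟩, hx⟩ := a
      refine Subtype.ext ?_
      change (x : B ⧸ (S i ⊔ N)) ^ n = 1
      rw [← QuotientGroup.mk_pow, QuotientGroup.eq_one_iff]
      exact le_sup_right (a := S i) (hexp x))
      fun p hp hpn => ⟨hprime p hp hpn, (hRb p (hprime p hp hpn)).2⟩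
    let f : B ⧸ (S i ⊔ N) →* B ⧸ (S (l - j) ⊔ N) :=
      QuotientGroup.map _ _ (MonoidHom.id B) hle'
    refine ⟨inferInstance, hC.of_ker f ih (hC.of_injective (inclusion ?_)
      (inclusion_injective ?_) hRC)⟩ <;>
    · rintro ⟨x⟩ hx
      have hx : ((x : B) : B ⧸ (S (l - j) ⊔ N)) = 1 := hx
      rw [QuotientGroup.eq_one_iff, hi1] at hx
      exact hR x hx

theorem CBoundedNilpotent.exists_inCStar (hC : IsRootClass C) (hquot : QuotClosed C)
    (hper : PeriodicClass C) (h : CBoundedNilpotent C B) {T Y : Subgroup B} (hT : T.Normal)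
    (hTY : inCStar C Y (T.subgroupOf Y)) : ∃ N, inCStar C B N ∧ N ⊓ Y ≤ T := by
  obtain ⟨N, hTN, hmax⟩ := exists_maximal_normal_inf_le (Y := Y) hT
  have := hmax.1.1
  have := h.isNilpotent
  obtain ⟨e, he, hexp⟩ : ∃ e : ℕ, 0 < e ∧ ∀ y ∈ Y, y ^ e ∈ T := by
    obtain ⟨_, hTY⟩ := hTY
    obtain ⟨e, he, h⟩ := hC.exists_exponent hper hTY
    refine ⟨e, he, fun y hy => ?_⟩
    have := h ((⟨y, hy⟩ : Y) : Y ⧸ T.subgroupOf Y)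
    rwa [← QuotientGroup.mk_pow, QuotientGroup.eq_one_iff, mem_subgroupOf] at this
  obtain ⟨m, hm, hprime, hmz⟩ := exists_exponent_center hTN hmax hTY he hexp
    fun q hq => h.exists_exponent_torsion N hq
  obtain ⟨c, hc⟩ := Group.IsNilpotent.exists_pow_eq_one (B ⧸ N) m hmz
  refine ⟨N, h.inCStar_of_exponent hC hquot N (pow_pos hm c)
    (fun q hq hqm => hprime q hq (hq.dvd_of_dvd_pow hqm)) fun x => ?_, hmax.1.2⟩
  rw [← QuotientGroup.eq_one_iff, QuotientGroup.mk_pow]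
  exact hc x

end

theorem statement_16 (C : GroupClass.{u}) (hroot : IsRootClass C) (hquot : QuotClosed C)
    {B : Type u} [Group B] (H K : Subgroup B) (φ : H ≃* K)
    (hH : H.Normal) (hK : K.Normal)
    (ψ : MulAut ↥(H ⊓ K)) (hψ : IsRestrictionToL H K φ ψ)
    (hHL : C (↥H ⧸ (H ⊓ K).subgroupOf H)) (hF : C ↥(Subgroup.zpowers ψ))
    (habc :
      (QuasiRegular C B (H ⊔ K) ∧ CondDag C H K φ ∧ C ↥(frakV H K ψ)) ∨
      (PeriodicClass C ∧ LocallyCyclic H ∧ LocallyCyclic K ∧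
        QuasiRegular C B (H ⊔ K)) ∨
      (PeriodicClass C ∧ CondDag C H K φ ∧ CondDDag C H K ψ ∧
        CBoundedNilpotent C B))
    (hBH : Residually C (B ⧸ H)) (hBK : Residually C (B ⧸ K)) :
    Residually C (HNNExtension B H K φ) ↔ Residually C B := by
  constructor
  · refine fun h => residually_of_forall hroot fun x hx => ?_
    obtain ⟨G, _, f, -, hG, hf⟩ := h (HNNExtension.of x)
      fun h1 => hx (HNNExtension.of_injective _ (h1.trans (map_one _).symm))
    exact ⟨G, _, f.comp HNNExtension.of, hG, hf⟩
  · intro hB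
    have hreg : QuasiRegular C B (H ⊔ K) → ∀ T : Subgroup B, T.Normal → T ≤ H ⊔ K →
        inCStar C ↥(H ⊔ K) (T.subgroupOf (H ⊔ K)) → ∃ N, inCStar C B N ∧ N ⊓ (H ⊔ K) ≤ T := by
      intro h T _ _ hT
      obtain ⟨N, hN, hNT⟩ := h _ hT
      exact ⟨N, hN, fun x hx => hNT (x := ⟨x, hx.2⟩) hx.1⟩
    rcases habc with ⟨hq, hdag, hV⟩ | ⟨-, hHcyc, -, hq⟩ | ⟨hper, hdag, hddag, hb⟩
    · exact HNNExtension.residually_of_residually hroot hquot hψ hHL hF hdag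
        (Or.inr (Or.inr hV)) (hreg hq) hBH hBK hB
    · exact HNNExtension.residually_of_residually hroot hquot hψ hHL hF
        (Or.inl (hHcyc.normalIn _ _))
        (Or.inl ((hHcyc.of_injective (inclusion inf_le_left)
          (inclusion_injective inf_le_left)).normalIn _ _)) (hreg hq) hBH hBK hB
    · exact HNNExtension.residually_of_residually hroot hquot hψ hHL hF hdag hddag
        (fun T hT _ hTY => hb.exists_inCStar hroot hquot hper hT hTY) hBH hBK hB
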